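/- Let B be a block of a profinite group G with defect group D ≅ Z_p. Then B has global dimension 1; in particular, for every simple B-module S with projective cover P_S, the kernel of the canonical surjection P_S → S is itself an indecomposable projective B-module. -/

import Mathlib

open scoped Classical
set_option maxHeartbeats 1000000
set_option synthInstance.maxHeartbeats 400000

noncomputable section

namespace ProfiniteBlocks

variable (k : Type) [Field k] (G : Type) [Group G] [TopologicalSpace G]

/-- Discrete topology on each finite level group algebra. -/
instance (X : Type) : TopologicalSpace (MonoidAlgebra k X) := ⊥

/-- The canonical quotient homomorphism `G/N → G/M` for `N ≤ M`. -/
def qHom (N M : OpenNormalSubgroup G) (h : N ≤ M) :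
    G ⧸ N.toSubgroup →* G ⧸ M.toSubgroup :=
  QuotientGroup.map _ _ (MonoidHom.id G) (fun x hx => h hx)

/-- The induced algebra homomorphism `k[G/N] → k[G/M]` for `N ≤ M`. -/
def tHom (N M : OpenNormalSubgroup G) (h : N ≤ M) :
    MonoidAlgebra k (G ⧸ N.toSubgroup) →ₐ[k] MonoidAlgebra k (G ⧸ M.toSubgroup) :=
  MonoidAlgebra.mapDomainAlgHom k k (qHom G N M h)

/-- The completed group algebra `k⟦G⟧`, realized as the inverse limit of the finite
level group algebras `k[G/N]` over all open normal subgroups `N` of `G`, sitting inside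
their product. -/
def CGA : Subalgebra k (∀ N : OpenNormalSubgroup G, MonoidAlgebra k (G ⧸ N.toSubgroup)) where
  carrier := {x | ∀ (N M : OpenNormalSubgroup G) (h : N ≤ M), tHom k G N M h (x N) = x M}
  add_mem' hx hy N M h := by simp [map_add, hx N M h, hy N M h]
  mul_mem' hx hy N M h := by simp [map_mul, hx N M h, hy N M h]
  algebraMap_mem' r N M h := by
    simp [tHom, MonoidAlgebra.mapDomainAlgHom, MonoidAlgebra.mapDomainRingHom,
      Finsupp.mapDomain_single]

instance : Ring (CGA k G) := inferInstance
instance : Algebra k (CGA k G) := inferInstance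

/-- `k⟦G⟧` carries the inverse limit topology (each `k[G/N]` being discrete). -/
instance : TopologicalSpace (CGA k G) := inferInstanceAs (TopologicalSpace (Subtype _))

/-- The canonical (continuous) inclusion of `G` into `k⟦G⟧`. -/
def ofG : G →* CGA k G where
  toFun g := ⟨fun N => MonoidAlgebra.single ((g : G) : G ⧸ N.toSubgroup) 1, by
    intro N M h
    simp [tHom, MonoidAlgebra.mapDomainAlgHom, MonoidAlgebra.mapDomainRingHom,
      Finsupp.mapDomain_single, qHom, QuotientGroup.map_mk]
    rfl⟩
  map_one' := by
    ext N
    simp [MonoidAlgebra.one_def]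
  map_mul' g g' := by
    ext N
    simp [MonoidAlgebra.single_mul_single]


/-- The map between quotient modules induced by `f` (the canonical map whenever
`f` carries `P` into `Q`). -/
def mapQ' {R X Y : Type} [Ring R] [AddCommGroup X] [AddCommGroup Y] [Module R X]
    [Module R Y] (P : Submodule R X) (Q : Submodule R Y) (f : X →ₗ[R] Y) :
    (X ⧸ P) →ₗ[R] (Y ⧸ Q) :=
  if h : P ≤ Q.comap f then Submodule.mapQ P Q f h else 0

/-- The map between submodules induced by `f` (the canonical restriction whenever
`f` carries `P` into `Q`). -/
def restrict' {R X Y : Type} [Ring R] [AddCommGroup X] [AddCommGroup Y] [Module R X]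
    [Module R Y] (P : Submodule R X) (Q : Submodule R Y) (f : X →ₗ[R] Y) :
    P →ₗ[R] Q :=
  if h : ∀ x ∈ P, f x ∈ Q then f.restrict h else 0

/-- The subquotient `W / W'` of a module. -/
abbrev subQuot {R X : Type} [Ring R] [AddCommGroup X] [Module R X]
    (W W' : Submodule R X) : Type :=
  W ⧸ (W'.comap W.subtype)

/-- The radical of a topological module: the intersection of its maximal open
submodules. -/
def radical (R : Type) [Ring R] (X : Type) [AddCommGroup X] [Module R X]
    [TopologicalSpace X] : Submodule R X :=
  sInf {W : Submodule R X | IsCoatom W ∧ IsOpen (W : Set X)}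

/-- Iterated radicals `Rad^i(X)`, with `Rad^0(X) = X`. -/
def radPow (R : Type) [Ring R] (X : Type) [AddCommGroup X] [Module R X]
    [TopologicalSpace X] : ℕ → Submodule R X
  | 0 => ⊤
  | (n + 1) => (radical R (radPow R X n)).map (radPow R X n).subtype

/-- A topological module is semisimple if every closed submodule has a closed
complement. -/
def IsSemisimpleTop (R : Type) [Ring R] (X : Type) [AddCommGroup X] [Module R X]
    [TopologicalSpace X] : Prop :=
  ∀ W : Submodule R X, IsClosed (W : Set X) →
    ∃ W' : Submodule R X, IsClosed (W' : Set X) ∧ IsCompl W W'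

/-- The socle of a topological module: the largest closed semisimple submodule
(defined as the join of all closed semisimple submodules). -/
def socle (R : Type) [Ring R] (X : Type) [AddCommGroup X] [Module R X]
    [TopologicalSpace X] : Submodule R X :=
  sSup {W : Submodule R X | IsClosed (W : Set X) ∧ IsSemisimpleTop R W}

/-- A module is uniserial if its submodules form a chain. -/
def Uniserial (R : Type) [Ring R] (X : Type) [AddCommGroup X] [Module R X] : Prop :=
  ∀ W W' : Submodule R X, W ≤ W' ∨ W' ≤ W

/-- A topological module is (topologically) indecomposable if it is non-zero and
admits no non-trivial decomposition into closed direct summands. -/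
def IsIndecTop (R : Type) [Ring R] (X : Type) [AddCommGroup X] [Module R X]
    [TopologicalSpace X] : Prop :=
  Nontrivial X ∧ ∀ W W' : Submodule R X, IsClosed (W : Set X) → IsClosed (W' : Set X) →
    IsCompl W W' → W = ⊥ ∨ W' = ⊥

/-- The inverse limit of a compatible system of modules indexed by a preorder,
realized as the submodule of compatible families in the product. -/
def compatLim {ι : Type} [Preorder ι] {R : Type} [Ring R] (T : ι → Type)
    [∀ i, AddCommGroup (T i)] [∀ i, Module R (T i)]
    (t : ∀ i j, i ≤ j → (T i →ₗ[R] T j)) : Submodule R (∀ i, T i) where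
  carrier := {f | ∀ (i j : ι) (h : i ≤ j), t i j h (f i) = f j}
  add_mem' ha hb i j h := by simp only [Pi.add_apply, map_add]; rw [ha i j h, hb i j h]
  zero_mem' i j h := by simp
  smul_mem' c a ha i j h := by simp only [Pi.smul_apply, map_smul]; rw [ha i j h]

/-- `X` has exactly `n` composition factors (measured along the radical series). -/
def HasNFactors (R : Type) [Ring R] (X : Type) [AddCommGroup X] [Module R X]
    [TopologicalSpace X] (n : ℕ) : Prop :=
  radPow R X n = ⊥ ∧ ∀ m < n, radPow R X m ≠ ⊥

/-- `X` has infinitely many composition factors. -/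
def HasInfFactors (R : Type) [Ring R] (X : Type) [AddCommGroup X] [Module R X]
    [TopologicalSpace X] : Prop :=
  ∀ n : ℕ, radPow R X n ≠ ⊥



section Coinvariants

variable {k : Type} [Field k] {G : Type} [Group G] [TopologicalSpace G]

variable (k G) in
/-- The (closed) submodule `I_N U` of a topological `k⟦G⟧`-module `U`: the smallest
closed submodule containing all elements `n • u - u` for `n ∈ N`.  Its quotient is the
module of `N`-coinvariants. -/
def coinvKer (N : OpenNormalSubgroup G) (U : Type) [AddCommGroup U]
    [Module (CGA k G) U] [TopologicalSpace U] : Submodule (CGA k G) U :=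
  sInf {W : Submodule (CGA k G) U | IsClosed (W : Set U) ∧
    ∀ n ∈ N.toSubgroup, ∀ u : U, ofG k G n • u - u ∈ W}

variable (k G) in
/-- The module of `N`-coinvariants `U_N` of a topological `k⟦G⟧`-module `U`. -/
abbrev coinv (N : OpenNormalSubgroup G) (U : Type) [AddCommGroup U]
    [Module (CGA k G) U] [TopologicalSpace U] : Type :=
  U ⧸ coinvKer k G N U

variable (k G) in
/-- The canonical projection `φ_N : U → U_N`. -/
def phi (N : OpenNormalSubgroup G) (U : Type) [AddCommGroup U]
    [Module (CGA k G) U] [TopologicalSpace U] : U →ₗ[CGA k G] coinv k G N U :=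
  (coinvKer k G N U).mkQ

lemma coinvKer_mono {N M : OpenNormalSubgroup G} (h : N ≤ M) (U : Type) [AddCommGroup U]
    [Module (CGA k G) U] [TopologicalSpace U] : coinvKer k G N U ≤ coinvKer k G M U :=
  sInf_le_sInf (fun W hW => ⟨hW.1, fun n hn u => hW.2 n (h hn) u⟩)

variable (k G) in
/-- The canonical projection `φ_{MN} : U_N → U_M` for `N ≤ M`. -/
def phiT (N M : OpenNormalSubgroup G) (h : N ≤ M) (U : Type) [AddCommGroup U]
    [Module (CGA k G) U] [TopologicalSpace U] :
    coinv k G N U →ₗ[CGA k G] coinv k G M U :=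
  Submodule.mapQ _ _ LinearMap.id (fun _ hx => coinvKer_mono h U hx)

variable (k G) in
/-- `N` acts trivially on the `k⟦G⟧`-module `W`. -/
def NTrivial (N : OpenNormalSubgroup G) (W : Type) [AddCommGroup W]
    [Module (CGA k G) W] : Prop :=
  ∀ n ∈ N.toSubgroup, ∀ w : W, ofG k G n • w = w

end Coinvariants

section Pseudocompact

variable (k : Type) [Field k]

/-- A pseudocompact module over a topological `k`-algebra `A`: a Hausdorff topological
module possessing a basis of neighbourhoods of `0` consisting of open submodules of
finite codimension which intersect in `0`, and which is the inverse limit of the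
corresponding discrete quotients. -/
structure IsPseudocompactMod (A : Type) [Ring A] [Algebra k A] [TopologicalSpace A]
    (X : Type) [AddCommGroup X] [Module k X] [Module A X] [IsScalarTower k A X]
    [TopologicalSpace X] : Prop where
  t2 : T2Space X
  addGroup : IsTopologicalAddGroup X
  contSMul : ContinuousSMul A X
  basis : (nhds (0 : X)).HasBasis
    (fun V : Submodule A X => IsOpen (V : Set X) ∧
      FiniteDimensional k (X ⧸ V.restrictScalars k))
    (fun V => (V : Set X))
  inf_bot : (⨅ (V : Submodule A X) (_ : IsOpen (V : Set X) ∧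
      FiniteDimensional k (X ⧸ V.restrictScalars k)), V) = ⊥
  complete : ∀ c : ∀ V : {V : Submodule A X // IsOpen (V : Set X) ∧
      FiniteDimensional k (X ⧸ V.restrictScalars k)}, X ⧸ V.1,
    (∀ (V W : {V : Submodule A X // IsOpen (V : Set X) ∧
        FiniteDimensional k (X ⧸ V.restrictScalars k)}), V.1 ≤ W.1 →
      mapQ' V.1 W.1 LinearMap.id (c V) = c W) →
    ∃ x : X, ∀ V, c V = Submodule.Quotient.mk x

end Pseudocompact

section Blocks

variable (R : Type) [Ring R]

/-- A block idempotent: a centrally primitive idempotent of `R`. -/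
structure IsBlockIdem (e : R) : Prop where
  idem : IsIdempotentElem e
  ne_zero : e ≠ 0
  central : e ∈ Set.center R
  primitive : ∀ f g : R, f ∈ Set.center R → g ∈ Set.center R → IsIdempotentElem f →
    IsIdempotentElem g → f * g = 0 → g * f = 0 → e = f + g → f = 0 ∨ g = 0

/-- The block `B = Re` determined by a central idempotent `e`, as a left `R`-module. -/
def blockMod (e : R) (he : e ∈ Set.center R) : Submodule R R where
  carrier := {a : R | a * e = a}
  add_mem' := by intro a b ha hb; simp only [Set.mem_setOf_eq, add_mul] at *; rw [ha, hb]
  zero_mem' := by simp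
  smul_mem' := by
    intro c a ha
    simp only [Set.mem_setOf_eq, smul_eq_mul, mul_assoc] at *
    rw [ha]

/-- A module belongs to the block of the central idempotent `e` if `e` acts as the
identity on it. -/
def InBlock {X : Type} [AddCommGroup X] [Module R X] (e : R) : Prop :=
  ∀ x : X, e • x = x

end Blocks

section Defect

variable {k : Type} [Field k] {G : Type} [Group G] [TopologicalSpace G]

variable (k G) in
/-- The conjugation action of `G` on `k⟦G⟧`. -/
def conjAct (g : G) (x : CGA k G) : CGA k G :=
  ofG k G g * x * ofG k G g⁻¹

variable (k G) in
/-- The `H`-fixed points of `k⟦G⟧` under conjugation. -/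
def fixedBy (H : Subgroup G) : Set (CGA k G) :=
  {x : CGA k G | ∀ h ∈ H, conjAct k G h x = x}

variable (k G) in
/-- The relative trace map `Tr_H^G` on `k⟦G⟧` (a finite sum over coset
representatives when `H` is open). -/
def trMap (H : Subgroup G) (x : CGA k G) : CGA k G :=
  ∑ᶠ c : G ⧸ H, conjAct k G (Quotient.out c) x

variable (k G) in
/-- The image `Tr_H^G(k⟦G⟧^H)`. -/
def trImage (H : Subgroup G) : Set (CGA k G) :=
  trMap k G H '' fixedBy k G H

variable (k G) in
/-- `D` satisfies the defect property for `e`: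
`e ∈ ⋂_N Tr_{DN}^G (k⟦G⟧^{DN})`. -/
def DefectProp (e : CGA k G) (D : Subgroup G) : Prop :=
  ∀ N : OpenNormalSubgroup G, e ∈ trImage k G (D ⊔ N.toSubgroup)

variable (k G) in
/-- `D` is a defect group of the block of `e`: a closed subgroup, minimal subject to
the defect property. -/
structure IsDefectGroup (e : CGA k G) (D : Subgroup G) : Prop where
  closed : IsClosed (D : Set G)
  defect : DefectProp k G e D
  minimal : ∀ D' : Subgroup G, IsClosed ((D' : Set G)) → D' ≤ D →
    DefectProp k G e D' → D' = D

end Defect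

section FiniteDefect

variable (k : Type) [Field k] (Q : Type) [Group Q]

/-- Conjugation on a finite level group algebra `k[Q]`. -/
def conjActF (q : Q) (x : MonoidAlgebra k Q) : MonoidAlgebra k Q :=
  MonoidAlgebra.single q 1 * x * MonoidAlgebra.single q⁻¹ 1

/-- `H`-fixed points of `k[Q]` under conjugation. -/
def fixedByF (H : Subgroup Q) : Set (MonoidAlgebra k Q) :=
  {x | ∀ h ∈ H, conjActF k Q h x = x}

/-- The relative trace map `Tr_H^Q` on `k[Q]`. -/
def trMapF (H : Subgroup Q) (x : MonoidAlgebra k Q) : MonoidAlgebra k Q :=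
  ∑ᶠ c : Q ⧸ H, conjActF k Q (Quotient.out c) x

/-- The image `Tr_H^Q(k[Q]^H)`. -/
def trImageF (H : Subgroup Q) : Set (MonoidAlgebra k Q) :=
  trMapF k Q H '' fixedByF k Q H

/-- `Dq` is a defect group of the block of `e` in the group algebra `k[Q]`. -/
structure IsDefectGroupF (e : MonoidAlgebra k Q) (Dq : Subgroup Q) : Prop where
  defect : e ∈ trImageF k Q Dq
  minimal : ∀ D' : Subgroup Q, D' ≤ Dq → e ∈ trImageF k Q D' → D' = Dq

end FiniteDefect

section CyclicDefect

variable {k : Type} [Field k] {G : Type} [Group G] [TopologicalSpace G]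

variable (G) in
/-- A subgroup is procyclic if it possesses a dense cyclic (abstract) subgroup. -/
def IsProcyclic (D : Subgroup G) : Prop :=
  ∃ g : G, closure ((Subgroup.zpowers g : Subgroup G) : Set G) = (D : Set G)

variable (G) in
/-- `D` is isomorphic, as a topological group, to the `p`-adic integers `ℤ_p`. -/
def IsZpGroup (p : ℕ) [Fact p.Prime] (D : Subgroup G) : Prop :=
  ∃ φ : D ≃ₜ Multiplicative ℤ_[p], ∀ x y : D, φ (x * y) = φ x * φ y

variable (G) in
/-- `D` is a cyclic pro-`p` group: either a finite cyclic `p`-group or `ℤ_p`. -/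
def IsCyclicProP (p : ℕ) [Fact p.Prime] (D : Subgroup G) : Prop :=
  (Finite D ∧ IsPGroup p D ∧ IsCyclic D) ∨ IsZpGroup G p D

end CyclicDefect

section Simples

variable {k : Type} [Field k] {G : Type} [Group G] [TopologicalSpace G]

variable (k G) in
/-- The projection `k⟦G⟧ → k[G/N]`. -/
def projN (N : OpenNormalSubgroup G) (x : CGA k G) :
    MonoidAlgebra k (G ⧸ N.toSubgroup) :=
  (x : ∀ N : OpenNormalSubgroup G, MonoidAlgebra k (G ⧸ N.toSubgroup)) N

variable (k G) in
/-- `N` acts trivially on every simple module of the block of `e`. -/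
def TrivOnSimples (e : CGA k G) (N : OpenNormalSubgroup G) : Prop :=
  ∀ (S : Type) [AddCommGroup S] [Module (CGA k G) S],
    IsSimpleModule (CGA k G) S → InBlock (CGA k G) (X := S) e → NTrivial k G N S

variable (k G) in
/-- Membership of `N` in the standard cofinal system `𝒩` for the block `B` of `e`
with defect group `D`: the coinvariant algebra `B_N` is a block of `k[G/N]` with
defect group `DN/N`, and `N` acts trivially on every simple `B`-module. -/
structure GoodN (e : CGA k G) (D : Subgroup G) (N : OpenNormalSubgroup G) : Prop where
  blockN : IsBlockIdem (MonoidAlgebra k (G ⧸ N.toSubgroup)) (projN k G N e)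
  defectN : IsDefectGroupF k (G ⧸ N.toSubgroup) (projN k G N e)
    (D.map (QuotientGroup.mk' N.toSubgroup))
  triv : TrivOnSimples k G e N

/-- A cofinal set of open normal subgroups. -/
def IsCofinal {G : Type} [Group G] [TopologicalSpace G]
    (𝒩 : Set (OpenNormalSubgroup G)) : Prop :=
  ∀ M : OpenNormalSubgroup G, ∃ N ∈ 𝒩, N ≤ M

variable (k G) in
/-- A pseudocompact module is pro-uniserial (w.r.t. the cofinal system `𝒩`) if all
its coinvariant quotients at members of `𝒩` are uniserial. -/
def ProUniserial (𝒩 : Set (OpenNormalSubgroup G)) (U : Type) [AddCommGroup U]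
    [Module (CGA k G) U] [TopologicalSpace U] : Prop :=
  ∀ N ∈ 𝒩, Uniserial (CGA k G) (coinv k G N U)

variable (k G) in
/-- `S` is a composition factor of the pseudocompact module `U`: it is a composition
factor of some finite coinvariant quotient `U_N`. -/
def IsCompFactorOf (U : Type) [AddCommGroup U] [Module (CGA k G) U]
    [TopologicalSpace U] (S : Type) [AddCommGroup S] [Module (CGA k G) S] : Prop :=
  ∃ (N : OpenNormalSubgroup G) (W W' : Submodule (CGA k G) (coinv k G N U)),
    W' ≤ W ∧ Nonempty (subQuot W W' ≃ₗ[CGA k G] S)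

variable (k G) in
/-- `S` is a composition factor of the finite-dimensional module `X`. -/
def IsCompFactorFin (X : Type) [AddCommGroup X] [Module (CGA k G) X]
    (S : Type) [AddCommGroup S] [Module (CGA k G) S] : Prop :=
  ∃ W W' : Submodule (CGA k G) X, W' ≤ W ∧ Nonempty (subQuot W W' ≃ₗ[CGA k G] S)

end Simples

section Projective

variable {k : Type} [Field k] {G : Type} [Group G] [TopologicalSpace G]

variable (k G) in
/-- A pseudocompact `k⟦G⟧`-module is (categorically) projective if every continuous
surjection onto it from a pseudocompact module splits. -/
def IsPCProjective (P : Type) [AddCommGroup P] [Module (CGA k G) P]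
    [TopologicalSpace P] : Prop :=
  ∀ (W : Type) [AddCommGroup W] [Module k W] [Module (CGA k G) W]
    [IsScalarTower k (CGA k G) W] [TopologicalSpace W],
    IsPseudocompactMod k (CGA k G) W →
    ∀ f : W →ₗ[CGA k G] P, Continuous f → Function.Surjective f →
      ∃ s : P →ₗ[CGA k G] W, Continuous s ∧ f.comp s = LinearMap.id

variable (k G) in
/-- `P` is a projective cover of the simple module `S` in the block of `e`:
a pseudocompact projective module of the block together with a surjection onto `S`
whose kernel is superfluous (contained in the radical). -/
structure IsProjCover (e : CGA k G) (P : Type) [AddCommGroup P] [Module k P]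
    [Module (CGA k G) P] [IsScalarTower k (CGA k G) P] [TopologicalSpace P]
    (S : Type) [AddCommGroup S] [Module (CGA k G) S] : Prop where
  pseudocompact : IsPseudocompactMod k (CGA k G) P
  inBlock : InBlock (CGA k G) (X := P) e
  projective : IsPCProjective k G P
  cover : ∃ π : P →ₗ[CGA k G] S, Function.Surjective π ∧
    LinearMap.ker π ≤ radical (CGA k G) P

end Projective




/-- The map between subquotients induced by `f`. -/
def subQuotMap {R X Y : Type} [Ring R] [AddCommGroup X] [AddCommGroup Y] [Module R X]
    [Module R Y] (W W' : Submodule R X) (V V' : Submodule R Y) (f : X →ₗ[R] Y) :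
    subQuot W W' →ₗ[R] subQuot V V' :=
  mapQ' (W'.comap W.subtype) (V'.comap V.subtype) (restrict' W V f)

/-- The conditions of Proposition 3.8 on a pair of pro-uniserial submodules `X`, `Y`
of an indecomposable projective `P`: `X ∩ Y = Soc(P)`, `X + Y = Rad(P)`, and
`Rad(P)/Soc(P) ≅ X/Soc(P) ⊕ Y/Soc(P)` with no common composition factors. -/
def ProUniserialPair (k : Type) [Field k] (G : Type) [Group G] [TopologicalSpace G]
    (𝒩 : Set (OpenNormalSubgroup G)) (P : Type) [AddCommGroup P]
    [Module (CGA k G) P] [TopologicalSpace P]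
    (X Y : Submodule (CGA k G) P) : Prop :=
  ProUniserial k G 𝒩 X ∧ ProUniserial k G 𝒩 Y ∧
  X ⊓ Y = socle (CGA k G) P ∧
  X ⊔ Y = radical (CGA k G) P ∧
  Nonempty ((subQuot (radical (CGA k G) P) (socle (CGA k G) P)) ≃ₗ[CGA k G]
    (subQuot X (socle (CGA k G) P) × subQuot Y (socle (CGA k G) P))) ∧
  ∀ (T : Type) [AddCommGroup T] [Module (CGA k G) T], IsSimpleModule (CGA k G) T →
    ¬ (IsCompFactorOf k G (subQuot X (socle (CGA k G) P)) T ∧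
       IsCompFactorOf k G (subQuot Y (socle (CGA k G) P)) T)

/-- `S : ι → Type` is a complete set of pairwise non-isomorphic representatives of
the simple modules of the block of `e`. -/
def IsSimpleReps (k : Type) [Field k] (G : Type) [Group G] [TopologicalSpace G]
    (e : CGA k G) {ι : Type} (S : ι → Type) [∀ i, AddCommGroup (S i)]
    [∀ i, Module (CGA k G) (S i)] : Prop :=
  (∀ i, IsSimpleModule (CGA k G) (S i) ∧ InBlock (CGA k G) (X := S i) e) ∧
  (∀ i j, i ≠ j → IsEmpty (S i ≃ₗ[CGA k G] S j)) ∧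
  (∀ (T : Type) [AddCommGroup T] [Module (CGA k G) T],
    IsSimpleModule (CGA k G) T → InBlock (CGA k G) (X := T) e →
      ∃ i, Nonempty (T ≃ₗ[CGA k G] S i))

section Brauer

/-- The size of the `ρ`-orbit of `i` (the number of edges at the corresponding vertex
of the Brauer tree). -/
def orbSize {ι : Type} (ρ : Equiv.Perm ι) (i : ι) : ℕ :=
  Function.minimalPeriod ρ i

/-- Data describing the exceptional vertex of a Brauer tree: `none` if there is no
exceptional vertex, and otherwise a flag recording whether it is a `ρ`-vertex or a
`σ`-vertex together with an edge adjacent to it. -/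
abbrev ExcVertex (ι : Type) : Type := Option (Bool × ι)

/-- The edge `i` is adjacent to the exceptional vertex, its `ρ`-endpoint being
exceptional. -/
def AdjExcRho {ι : Type} (ρ : Equiv.Perm ι) (exc : ExcVertex ι) (i : ι) : Prop :=
  ∃ j : ι, exc = some (true, j) ∧ ρ.SameCycle j i

/-- The edge `i` is adjacent to the exceptional vertex, its `σ`-endpoint being
exceptional. -/
def AdjExcSigma {ι : Type} (σ : Equiv.Perm ι) (exc : ExcVertex ι) (i : ι) : Prop :=
  ∃ j : ι, exc = some (false, j) ∧ σ.SameCycle j i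

/-- The edge `i` is adjacent to the exceptional vertex. -/
def AdjExc {ι : Type} (ρ σ : Equiv.Perm ι) (exc : ExcVertex ι) (i : ι) : Prop :=
  AdjExcRho ρ exc i ∨ AdjExcSigma σ exc i

end Brauer


section LinearTopology

theorem isOpen_of_submodule_le {R X : Type} [Ring R] [AddCommGroup X] [Module R X]
    [TopologicalSpace X] [IsTopologicalAddGroup X] {V W : Submodule R X} (h : V ≤ W)
    (hV : IsOpen (V : Set X)) : IsOpen (W : Set X) :=
  AddSubgroup.isOpen_mono (H₁ := V.toAddSubgroup) (H₂ := W.toAddSubgroup) h hV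

theorem isClosed_of_submodule_isOpen {R X : Type} [Ring R] [AddCommGroup X] [Module R X]
    [TopologicalSpace X] [IsTopologicalAddGroup X] {V : Submodule R X}
    (hV : IsOpen (V : Set X)) : IsClosed (V : Set X) :=
  AddSubgroup.isClosed_of_isOpen V.toAddSubgroup hV

theorem finiteDimensional_quotient_of_le {k X : Type} [Field k] [AddCommGroup X] [Module k X]
    {V W : Submodule k X} (h : V ≤ W) [FiniteDimensional k (X ⧸ V)] :
    FiniteDimensional k (X ⧸ W) :=
  Module.Finite.of_surjective (Submodule.mapQ V W LinearMap.id h) (by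
    intro y
    obtain ⟨x, rfl⟩ := Submodule.Quotient.mk_surjective _ y
    exact ⟨Submodule.Quotient.mk x, rfl⟩)

theorem finiteDimensional_quotient_of_comap_le {k X Y : Type} [Field k] [AddCommGroup X]
    [Module k X] [AddCommGroup Y] [Module k Y] (f : X →ₗ[k] Y) {V : Submodule k Y}
    {W : Submodule k X} (h : V.comap f ≤ W) [FiniteDimensional k (Y ⧸ V)] :
    FiniteDimensional k (X ⧸ W) := by
  have : FiniteDimensional k (X ⧸ V.comap f) :=
    Module.Finite.of_injective (Submodule.mapQ _ V f le_rfl) (by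
      rw [← LinearMap.ker_eq_bot, Submodule.ker_mapQ]
      simp)
  exact finiteDimensional_quotient_of_le h

/-- A linearly topologized vector space: the open subspaces of finite codimension form a
basis of neighbourhoods of `0`. -/
structure IsLinTop (k X : Type) [Field k] [AddCommGroup X] [Module k X]
    [TopologicalSpace X] : Prop where
  t2 : T2Space X
  addGroup : IsTopologicalAddGroup X
  basis : ∀ s ∈ nhds (0 : X), ∃ V : Submodule k X, IsOpen (V : Set X) ∧
    FiniteDimensional k (X ⧸ V) ∧ (V : Set X) ⊆ s

/-- A linearly compact vector space: downwards directed families of cosets of closed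
subspaces have a common point. -/
structure IsLinCpt (k X : Type) [Field k] [AddCommGroup X] [Module k X]
    [TopologicalSpace X] : Prop extends IsLinTop k X where
  inter : ∀ {ι : Type} [Nonempty ι] (C : ι → Submodule k X) (x : ι → X),
    (∀ i, IsClosed (C i : Set X)) →
    (∀ i j, ∃ l, C l ≤ C i ∧ C l ≤ C j ∧ x l - x i ∈ C i ∧ x l - x j ∈ C j) →
    ∃ y, ∀ i, y - x i ∈ C i

variable {k : Type} [Field k] {X Y : Type} [AddCommGroup X] [Module k X] [TopologicalSpace X]
  [AddCommGroup Y] [Module k Y] [TopologicalSpace Y]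

theorem IsLinTop.exists_isOpen_sep (hX : IsLinTop k X) {C : Submodule k X}
    (hC : IsClosed (C : Set X)) {y : X} (hy : y ∉ C) :
    ∃ W : Submodule k X, IsOpen (W : Set X) ∧ FiniteDimensional k (X ⧸ W) ∧ C ≤ W ∧ y ∉ W := by
  have := hX.addGroup
  have h1 : {v : X | y + v ∈ (C : Set X)ᶜ} ∈ nhds (0 : X) := by
    have hc : Continuous fun v : X => y + v := by fun_prop
    exact hc.continuousAt.preimage_mem_nhds (hC.isOpen_compl.mem_nhds (by simpa using hy))
  obtain ⟨V, hV, hVf, hVs⟩ := hX.basis _ h1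
  refine ⟨C ⊔ V, isOpen_of_submodule_le le_sup_right hV,
    finiteDimensional_quotient_of_le (V := V) le_sup_right, le_sup_left, fun h => ?_⟩
  obtain ⟨c, hc, v, hv, rfl⟩ := Submodule.mem_sup.1 h
  have := hVs (V.neg_mem hv)
  simp only [Set.mem_ofPred_eq, add_neg_cancel_right] at this
  exact this hc

theorem IsLinTop.exists_functional (hX : IsLinTop k X) {C : Submodule k X}
    (hC : IsClosed (C : Set X)) {y : X} (hy : y ∉ C) :
    ∃ f : X →ₗ[k] k, IsOpen (LinearMap.ker f : Set X) ∧ C ≤ LinearMap.ker f ∧ f y = 1 := by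
  have := hX.addGroup
  obtain ⟨W, hW, -, hCW, hyW⟩ := hX.exists_isOpen_sep hC hy
  obtain ⟨f, hf, hWf⟩ := Submodule.exists_le_ker_of_notMem hyW
  have hk : LinearMap.ker f ≤ LinearMap.ker ((f y)⁻¹ • f) := fun x hx => by
    simp [LinearMap.mem_ker.1 hx]
  refine ⟨(f y)⁻¹ • f, isOpen_of_submodule_le (hWf.trans hk) hW, (hCW.trans hWf).trans hk, ?_⟩
  simp [hf]

theorem IsLinTop.isOpen_of_isClosed (hX : IsLinTop k X) {C : Submodule k X}
    (hC : IsClosed (C : Set X)) [FiniteDimensional k (X ⧸ C)] : IsOpen (C : Set X) := by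
  have := hX.addGroup
  obtain ⟨M, hM, hmin⟩ := IsArtinian.set_has_minimal (R := k)
    {W : Submodule k (X ⧸ C) | IsOpen (W.comap C.mkQ : Set X)} ⟨⊤, by
      simp⟩
  suffices h : M = ⊥ by
    subst h
    have : IsOpen ((⊥ : Submodule k (X ⧸ C)).comap C.mkQ : Set X) := hM
    have h2 : (⊥ : Submodule k (X ⧸ C)).comap C.mkQ = C := by
      rw [Submodule.comap_bot, Submodule.ker_mkQ]
    rwa [h2] at this
  by_contra hne
  obtain ⟨z, hz, hz0⟩ := Submodule.exists_mem_ne_zero_of_ne_bot hne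
  obtain ⟨y, rfl⟩ := C.mkQ_surjective z
  have hy : y ∉ C := by simpa using hz0
  obtain ⟨W, hW, -, hCW, hyW⟩ := hX.exists_isOpen_sep hC hy
  refine hmin (M ⊓ W.map C.mkQ) ?_ (lt_of_le_of_ne inf_le_left fun h => ?_)
  · have : IsOpen ((M.comap C.mkQ ⊓ W : Submodule k X) : Set X) := hM.inter hW
    refine isOpen_of_submodule_le ?_ this
    rw [Submodule.comap_inf]
    exact inf_le_inf le_rfl (Submodule.le_comap_map _ _)
  · rw [← h] at hz
    obtain ⟨w, hw, hwy⟩ := hz.2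
    have : y - w ∈ C := (Submodule.Quotient.eq C).1 hwy.symm
    exact hyW (by simpa using W.add_mem (hCW this) hw)

theorem IsLinCpt.isClosed_map (hX : IsLinCpt k X) (hY : IsLinTop k Y) (f : X →ₗ[k] Y)
    (hf : Continuous f) {C : Submodule k X} (hC : IsClosed (C : Set X)) :
    IsClosed (C.map f : Set Y) := by
  have := hX.addGroup
  have := hY.addGroup
  have := hY.t2
  rw [← closure_subset_iff_isClosed]
  intro y hy
  let ι := {V : Submodule k Y // IsOpen (V : Set Y)}
  have : Nonempty ι := ⟨⟨⊤, isOpen_univ⟩⟩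
  have hne : ∀ V : ι, ∃ x ∈ C, f x - y ∈ V.1 := by
    intro V
    have : {z : Y | z - y ∈ (V.1 : Set Y)} ∈ nhds y := by
      have hc : Continuous fun z : Y => z - y := by fun_prop
      exact hc.continuousAt.preimage_mem_nhds (V.2.mem_nhds (by simp))
    obtain ⟨z, hz, x, hx, rfl⟩ := mem_closure_iff_nhds.1 hy _ this
    exact ⟨x, hx, hz⟩
  choose x hxC hxV using hne
  obtain ⟨x0, hx0⟩ := hX.inter (fun V : ι => C ⊓ V.1.comap f) x
    (fun V => hC.inter ((isClosed_of_submodule_isOpen V.2).preimage hf)) (by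
      intro V W
      refine ⟨⟨V.1 ⊓ W.1, V.2.inter W.2⟩, ?_, ?_, ?_, ?_⟩
      · exact inf_le_inf le_rfl (Submodule.comap_mono inf_le_left)
      · exact inf_le_inf le_rfl (Submodule.comap_mono inf_le_right)
      · refine ⟨C.sub_mem (hxC _) (hxC _), ?_⟩
        have := V.1.sub_mem (hxV ⟨V.1 ⊓ W.1, V.2.inter W.2⟩).1 (hxV V)
        simpa using this
      · refine ⟨C.sub_mem (hxC _) (hxC _), ?_⟩
        have := W.1.sub_mem (hxV ⟨V.1 ⊓ W.1, V.2.inter W.2⟩).2 (hxV W)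
        simpa using this)
  have hmem : x0 ∈ C := by
    have := C.add_mem (hx0 ⟨⊤, isOpen_univ⟩).1 (hxC ⟨⊤, isOpen_univ⟩)
    simpa using this
  refine ⟨x0, hmem, ?_⟩
  by_contra hne
  obtain ⟨W, hW, -, -, hyW⟩ := hY.exists_isOpen_sep (C := ⊥) (by simp)
    (y := f x0 - y) (by simpa [sub_eq_zero] using hne)
  apply hyW
  have := W.add_mem (hx0 ⟨W, hW⟩).2 (hxV ⟨W, hW⟩)
  simpa using this

/-- A linear map from a subspace, killing a relatively open subspace, extends. -/
theorem IsLinTop.exists_extend (hX : IsLinTop k X) {E : Type} [AddCommGroup E] [Module k E]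
    {U : Submodule k X} (q : U →ₗ[k] E) (hq : IsOpen (LinearMap.ker q : Set U)) :
    ∃ f : X →ₗ[k] E, IsOpen (LinearMap.ker f : Set X) ∧ ∀ u : U, f u = q u := by
  have := hX.addGroup
  obtain ⟨s, hs, hsq⟩ := isOpen_induced_iff.1 hq
  have h0 : s ∈ nhds (0 : X) := hs.mem_nhds (by
    have : (0 : U) ∈ Subtype.val ⁻¹' s := by rw [hsq]; exact (LinearMap.ker q).zero_mem
    simpa using this)
  obtain ⟨V, hV, -, hVs⟩ := hX.basis _ h0
  have hker : ∀ u : U, (u : X) ∈ V → q u = 0 := by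
    intro u hu
    have : u ∈ Subtype.val ⁻¹' s := hVs hu
    rw [hsq] at this
    exact this
  let g : U →ₗ[k] X ⧸ V := V.mkQ ∘ₗ U.subtype
  have hg : LinearMap.ker g ≤ LinearMap.ker q := fun u hu => hker u (by simpa [g] using hu)
  obtain ⟨f, hf⟩ := LinearMap.exists_extend
    (((LinearMap.ker g).liftQ q hg) ∘ₗ g.quotKerEquivRange.symm.toLinearMap)
  refine ⟨f ∘ₗ V.mkQ, isOpen_of_submodule_le (V := V) (fun v hv => ?_) hV, fun u => ?_⟩
  · simp [(Submodule.Quotient.mk_eq_zero V).2 hv]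
  · have := LinearMap.congr_fun hf (⟨g u, ⟨u, rfl⟩⟩ : LinearMap.range g)
    simp only [LinearMap.comp_apply, Submodule.subtype_apply] at this
    rw [LinearMap.comp_apply]
    refine this.trans ?_
    have h2 : (⟨g u, ⟨u, rfl⟩⟩ : LinearMap.range g) =
      g.quotKerEquivRange (Submodule.Quotient.mk u) := rfl
    simp only [LinearEquiv.coe_coe]
    rw [h2, LinearEquiv.symm_apply_apply]
    rfl

/-- An open mapping theorem for linearly compact spaces. -/
theorem IsLinCpt.isOpen_map (hX : IsLinCpt k X) (hY : IsLinTop k Y) (f : X →ₗ[k] Y)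
    (hf : Continuous f) (hs : Function.Surjective f) {V : Submodule k X}
    (hV : IsOpen (V : Set X)) : IsOpen (V.map f : Set Y) := by
  have := hX.addGroup
  have := hY.addGroup
  obtain ⟨V', hV', hfin, hle⟩ := hX.basis _ (hV.mem_nhds V.zero_mem)
  have : FiniteDimensional k (Y ⧸ V'.map f) :=
    Module.Finite.of_surjective (Submodule.mapQ V' (V'.map f) f (Submodule.le_comap_map _ _)) (by
      intro y
      obtain ⟨y, rfl⟩ := Submodule.Quotient.mk_surjective _ y
      obtain ⟨x, rfl⟩ := hs y
      exact ⟨Submodule.Quotient.mk x, rfl⟩)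
  exact isOpen_of_submodule_le (Submodule.map_mono hle)
    (hY.isOpen_of_isClosed (hX.isClosed_map hY f hf (isClosed_of_submodule_isOpen hV')))

end LinearTopology

section Pseudocompact

variable {k : Type} [Field k] {A : Type} [Ring A] [Algebra k A] [TopologicalSpace A]
  {X : Type} [AddCommGroup X] [Module k X] [Module A X] [IsScalarTower k A X]
  [TopologicalSpace X]

theorem IsPseudocompactMod.isLinTop (hX : IsPseudocompactMod k A X) : IsLinTop k X where
  t2 := hX.t2
  addGroup := hX.addGroup
  basis s hs := by
    obtain ⟨V, hV, hVs⟩ := hX.basis.mem_iff.1 hs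
    exact ⟨V.restrictScalars k, hV.1, hV.2, hVs⟩

/-- Pseudocompact modules are reflexive for the duality by functionals with open kernel. -/
theorem IsPseudocompactMod.exists_eval (hX : IsPseudocompactMod k A X)
    (φ : Module.Dual k (Module.Dual k X)) :
    ∃ x : X, ∀ f : Module.Dual k X, IsOpen (LinearMap.ker f : Set X) → φ f = f x := by
  have hfin : ∀ V : {V : Submodule A X // IsOpen (V : Set X) ∧
      FiniteDimensional k (X ⧸ V.restrictScalars k)}, FiniteDimensional k (X ⧸ V.1) := by
    intro V
    have := V.2.2
    exact Module.Finite.equiv (Submodule.Quotient.restrictScalarsEquiv k V.1)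
  have hc : ∀ V : {V : Submodule A X // IsOpen (V : Set X) ∧
      FiniteDimensional k (X ⧸ V.restrictScalars k)}, ∃ c : X ⧸ V.1,
      ∀ μ : Module.Dual k (X ⧸ V.1), μ c = φ (μ ∘ₗ V.1.mkQ.restrictScalars k) := by
    intro V
    have := hfin V
    obtain ⟨c, hc⟩ := (Module.evalEquiv k (X ⧸ V.1)).surjective
      (φ ∘ₗ (LinearMap.lcomp k k (V.1.mkQ.restrictScalars k)))
    exact ⟨c, fun μ => LinearMap.congr_fun hc μ⟩
  choose c hc using hc
  obtain ⟨x, hx⟩ := hX.complete c (by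
    intro V W h
    rw [← sub_eq_zero, ← Module.forall_dual_apply_eq_zero_iff k]
    intro ν
    have h' : V.1 ≤ W.1.comap (LinearMap.id : X →ₗ[A] X) := h
    rw [map_sub, hc W, sub_eq_zero, mapQ', dif_pos h']
    exact hc V (ν ∘ₗ (Submodule.mapQ V.1 W.1 LinearMap.id h').restrictScalars k))
  refine ⟨x, fun f hf => ?_⟩
  obtain ⟨V, hV, hVf⟩ := hX.basis.mem_iff.1 (hf.mem_nhds (LinearMap.ker f).zero_mem)
  have hle : V.restrictScalars k ≤ LinearMap.ker f := hVf
  let μ : Module.Dual k (X ⧸ V) := ((V.restrictScalars k).liftQ f hle) ∘ₗ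
    (Submodule.Quotient.restrictScalarsEquiv k V).symm.toLinearMap
  have hμ : μ ∘ₗ V.mkQ.restrictScalars k = f := by
    ext y
    rfl
  have h1 := hc ⟨V, hV⟩ μ
  rw [hμ, hx ⟨V, hV⟩] at h1
  exact h1.symm

/-- Reflexive linearly topologized spaces are linearly compact. -/
theorem IsLinTop.isLinCpt {X : Type} [AddCommGroup X] [Module k X] [TopologicalSpace X]
    (hX : IsLinTop k X) (hrefl : ∀ φ : Module.Dual k (Module.Dual k X), ∃ x : X,
      ∀ f : Module.Dual k X, IsOpen (LinearMap.ker f : Set X) → φ f = f x) : IsLinCpt k X where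
  toIsLinTop := hX
  inter {ι} _ C x hC hdir := by
    have hwd : ∀ (f : Module.Dual k X) (i j : ι), C i ≤ LinearMap.ker f → C j ≤ LinearMap.ker f →
        f (x i) = f (x j) := by
      intro f i j hi hj
      obtain ⟨l, -, -, hli, hlj⟩ := hdir i j
      have h1 := hi hli
      have h2 := hj hlj
      rw [LinearMap.mem_ker, map_sub, sub_eq_zero] at h1 h2
      rw [← h1, h2]
    let M : Submodule k (Module.Dual k X) :=
      { carrier := {f | ∃ i, C i ≤ LinearMap.ker f}
        add_mem' := by
          rintro f g ⟨i, hi⟩ ⟨j, hj⟩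
          obtain ⟨l, hli, hlj, -, -⟩ := hdir i j
          exact ⟨l, fun y hy => by simp [LinearMap.mem_ker.1 (hi (hli hy)),
            LinearMap.mem_ker.1 (hj (hlj hy))]⟩
        zero_mem' := ⟨Classical.arbitrary ι, by simp⟩
        smul_mem' := by
          rintro a f ⟨i, hi⟩
          exact ⟨i, fun y hy => by simp [LinearMap.mem_ker.1 (hi hy)]⟩ }
    let ψ : M →ₗ[k] k :=
      { toFun := fun f => f.1 (x f.2.choose)
        map_add' := by
          intro f g
          obtain ⟨l, hli, hlj, -, -⟩ := hdir f.2.choose g.2.choose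
          have hf := hli.trans f.2.choose_spec
          have hg := hlj.trans g.2.choose_spec
          rw [hwd _ _ l (f + g).2.choose_spec (fun y hy => by
              simp [LinearMap.mem_ker.1 (hf hy), LinearMap.mem_ker.1 (hg hy)]),
            hwd f.1 _ l f.2.choose_spec hf, hwd g.1 _ l g.2.choose_spec hg]
          rfl
        map_smul' := by
          intro a f
          rw [hwd _ _ f.2.choose (a • f).2.choose_spec (fun y hy => by
              simp [LinearMap.mem_ker.1 (f.2.choose_spec hy)])]
          rfl }
    obtain ⟨φ, hφ⟩ := LinearMap.exists_extend ψ
    obtain ⟨y, hy⟩ := hrefl φ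
    refine ⟨y, fun i => ?_⟩
    by_contra hne
    obtain ⟨f, hf, hCf, hf1⟩ := hX.exists_functional (hC i) hne
    have h1 : φ f = f (x i) := by
      have hm := LinearMap.congr_fun hφ ⟨f, i, hCf⟩
      exact hm.trans (hwd f _ i (Exists.choose_spec (⟨i, hCf⟩ : ∃ i, C i ≤ LinearMap.ker f)) hCf)
    rw [hy f hf] at h1
    rw [map_sub, h1, sub_self] at hf1
    exact zero_ne_one hf1

theorem IsPseudocompactMod.isLinCpt (hX : IsPseudocompactMod k A X) : IsLinCpt k X :=
  hX.isLinTop.isLinCpt hX.exists_eval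

theorem isPseudocompactMod_of_isLinCpt (hX : IsLinCpt k X) (hs : ContinuousSMul A X)
    (hb : ∀ s ∈ nhds (0 : X), ∃ V : Submodule A X, IsOpen (V : Set X) ∧
      FiniteDimensional k (X ⧸ V.restrictScalars k) ∧ (V : Set X) ⊆ s) :
    IsPseudocompactMod k A X where
  t2 := hX.t2
  addGroup := hX.addGroup
  contSMul := hs
  basis := by
    refine ⟨fun s => ⟨fun h => ?_, ?_⟩⟩
    · obtain ⟨V, h1, h2, h3⟩ := hb s h
      exact ⟨V, ⟨h1, h2⟩, h3⟩
    · rintro ⟨V, ⟨h1, -⟩, h3⟩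
      exact Filter.mem_of_superset (h1.mem_nhds V.zero_mem) h3
  inf_bot := by
    have := hX.t2
    rw [eq_bot_iff]
    intro x hx
    by_contra hne
    obtain ⟨V, h1, h2, h3⟩ := hb {x}ᶜ (isOpen_compl_singleton.mem_nhds (by
      simpa [eq_comm] using hne))
    simp only [Submodule.mem_iInf] at hx
    exact h3 (hx V ⟨h1, h2⟩) rfl
  complete := by
    intro c hc
    have := hX.addGroup
    let ι := {V : Submodule A X // IsOpen (V : Set X) ∧
      FiniteDimensional k (X ⧸ V.restrictScalars k)}
    have hne : Nonempty ι := by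
      obtain ⟨V, h1, h2, -⟩ := hb Set.univ Filter.univ_mem
      exact ⟨⟨V, h1, h2⟩⟩
    choose x hx using fun V : ι => Submodule.Quotient.mk_surjective V.1 (c V)
    have key : ∀ V W : ι, V.1 ≤ W.1 → x V - x W ∈ W.1 := by
      intro V W h
      rw [← Submodule.Quotient.eq, hx W, ← hc V W h, ← hx V, mapQ',
        dif_pos (show V.1 ≤ W.1.comap LinearMap.id from h)]
      rfl
    obtain ⟨y, hy⟩ := hX.inter (fun V : ι => V.1.restrictScalars k) x
      (fun V => isClosed_of_submodule_isOpen V.2.1) (by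
        intro V W
        obtain ⟨U, h1, h2, h3⟩ := hb (V.1 ∩ W.1) ((V.2.1.inter W.2.1).mem_nhds
          ⟨V.1.zero_mem, W.1.zero_mem⟩)
        have hV : U ≤ V.1 := fun u hu => (h3 hu).1
        have hW : U ≤ W.1 := fun u hu => (h3 hu).2
        exact ⟨⟨U, h1, h2⟩, hV, hW, key ⟨U, h1, h2⟩ V hV, key ⟨U, h1, h2⟩ W hW⟩)
    refine ⟨y, fun V => ?_⟩
    rw [← hx V, eq_comm]
    exact (Submodule.Quotient.eq V.1).2 (hy V)

theorem isPseudocompactMod_of_eval (hX : IsLinTop k X)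
    (hrefl : ∀ φ : Module.Dual k (Module.Dual k X), ∃ x : X,
      ∀ f : Module.Dual k X, IsOpen (LinearMap.ker f : Set X) → φ f = f x)
    (hs : ContinuousSMul A X)
    (hb : ∀ s ∈ nhds (0 : X), ∃ V : Submodule A X, IsOpen (V : Set X) ∧
      FiniteDimensional k (X ⧸ V.restrictScalars k) ∧ (V : Set X) ⊆ s) :
    IsPseudocompactMod k A X :=
  isPseudocompactMod_of_isLinCpt (hX.isLinCpt hrefl) hs hb

theorem IsPseudocompactMod.exists_submodule (hX : IsPseudocompactMod k A X) {s : Set X}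
    (hs : s ∈ nhds (0 : X)) : ∃ V : Submodule A X, IsOpen (V : Set X) ∧
      FiniteDimensional k (X ⧸ V.restrictScalars k) ∧ (V : Set X) ⊆ s := by
  obtain ⟨V, hV, hVs⟩ := hX.basis.mem_iff.1 hs
  exact ⟨V, hV.1, hV.2, hVs⟩

theorem IsLinCpt.of_isClosed (hX : IsLinCpt k X) {C : Submodule k X}
    (hC : IsClosed (C : Set X)) : IsLinCpt k C where
  t2 := by
    have := hX.t2
    infer_instance
  addGroup := by
    have := hX.addGroup
    infer_instance
  basis s hs := by
    rw [mem_nhds_subtype] at hs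
    obtain ⟨u, hu, hus⟩ := hs
    obtain ⟨V, hV, hf, hVs⟩ := hX.basis u hu
    refine ⟨V.comap C.subtype, hV.preimage continuous_subtype_val, ?_, fun v hv => hus (hVs hv)⟩
    exact finiteDimensional_quotient_of_comap_le C.subtype (V := V) le_rfl
  inter {ι} _ D x hD hdir := by
    obtain ⟨y, hy⟩ := hX.inter (fun i => (D i).map C.subtype) (fun i => (x i : X))
      (fun i => hC.isClosedEmbedding_subtypeVal.isClosedMap _ (hD i)) (by
        intro i j
        obtain ⟨l, h1, h2, h3, h4⟩ := hdir i j
        exact ⟨l, Submodule.map_mono h1, Submodule.map_mono h2, ⟨_, h3, rfl⟩, ⟨_, h4, rfl⟩⟩)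
    obtain ⟨i⟩ := ‹Nonempty ι›
    obtain ⟨z, -, hz⟩ := hy i
    have hyC : y ∈ C := by
      have := C.add_mem z.2 (x i).2
      rw [Submodule.subtype_apply] at hz
      rw [hz] at this
      simpa using this
    refine ⟨⟨y, hyC⟩, fun j => ?_⟩
    obtain ⟨w, hw, hw'⟩ := hy j
    have : w = ⟨y, hyC⟩ - x j := Subtype.ext hw'
    exact this ▸ hw

theorem IsPseudocompactMod.of_isClosed (hX : IsPseudocompactMod k A X) {C : Submodule A X}
    (hC : IsClosed (C : Set X)) : IsPseudocompactMod k A C := by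
  have h1 : IsLinCpt k (C.restrictScalars k) := hX.isLinCpt.of_isClosed hC
  refine isPseudocompactMod_of_isLinCpt ⟨⟨h1.t2, h1.addGroup, h1.basis⟩, h1.inter⟩ ?_ ?_
  · have := hX.contSMul
    infer_instance
  · intro s hs
    rw [mem_nhds_subtype] at hs
    obtain ⟨u, hu, hus⟩ := hs
    obtain ⟨V, hV, hf, hVs⟩ := hX.exists_submodule hu
    refine ⟨V.comap C.subtype, hV.preimage continuous_subtype_val, ?_, fun v hv => hus (hVs hv)⟩
    exact finiteDimensional_quotient_of_comap_le (C.subtype.restrictScalars k)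
      (V := V.restrictScalars k) le_rfl

end Pseudocompact

section Reflexive

variable {k : Type} [Field k] {A : Type} [Ring A] [Algebra k A] [TopologicalSpace A]
  {X Y : Type} [AddCommGroup X] [Module k X] [Module A X] [IsScalarTower k A X]
  [TopologicalSpace X] [AddCommGroup Y] [Module k Y] [Module A Y] [IsScalarTower k A Y]
  [TopologicalSpace Y]

theorem finiteDimensional_quotient_of_ker_le {k X E : Type} [Field k] [AddCommGroup X]
    [Module k X] [AddCommGroup E] [Module k E] [FiniteDimensional k E] (f : X →ₗ[k] E)
    {W : Submodule k X} (h : LinearMap.ker f ≤ W) : FiniteDimensional k (X ⧸ W) :=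
  finiteDimensional_quotient_of_comap_le f (V := ⊥) (by simpa using h)

theorem IsPseudocompactMod.prod (hX : IsPseudocompactMod k A X) (hY : IsPseudocompactMod k A Y) :
    IsPseudocompactMod k A (X × Y) := by
  have := hX.t2
  have := hY.t2
  have := hX.addGroup
  have := hY.addGroup
  have := hX.contSMul
  have := hY.contSMul
  have hb : ∀ s ∈ nhds (0 : X × Y), ∃ V : Submodule A (X × Y), IsOpen (V : Set (X × Y)) ∧
      FiniteDimensional k ((X × Y) ⧸ V.restrictScalars k) ∧ (V : Set (X × Y)) ⊆ s := by
    intro s hs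
    obtain ⟨u, hu, v, hv, huv⟩ := mem_nhds_prod_iff.1 hs
    obtain ⟨V, hV, hVf, hVu⟩ := hX.exists_submodule hu
    obtain ⟨W, hW, hWf, hWv⟩ := hY.exists_submodule hv
    refine ⟨V.prod W, hV.prod hW, finiteDimensional_quotient_of_ker_le
      (((V.restrictScalars k).mkQ).prodMap ((W.restrictScalars k).mkQ)) ?_,
      fun x hx => huv ⟨hVu hx.1, hWv hx.2⟩⟩
    rintro ⟨x, y⟩ hxy
    simpa using hxy
  refine isPseudocompactMod_of_eval ⟨inferInstance, inferInstance, fun s hs => ?_⟩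
    (fun φ => ?_) inferInstance hb
  · obtain ⟨V, h⟩ := hb s hs
    exact ⟨V.restrictScalars k, h⟩
  · obtain ⟨x, hx⟩ := hX.exists_eval (φ ∘ₗ (LinearMap.fst k X Y).dualMap)
    obtain ⟨y, hy⟩ := hY.exists_eval (φ ∘ₗ (LinearMap.snd k X Y).dualMap)
    refine ⟨(x, y), fun f hf => ?_⟩
    have h1 := hx (f ∘ₗ LinearMap.inl k X Y)
      (hf.preimage (f := fun x : X => (x, (0 : Y))) (by fun_prop))
    have h2 := hy (f ∘ₗ LinearMap.inr k X Y)
      (hf.preimage (f := fun y : Y => ((0 : X), y)) (by fun_prop))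
    have h3 : f = (LinearMap.fst k X Y).dualMap (f ∘ₗ LinearMap.inl k X Y) +
        (LinearMap.snd k X Y).dualMap (f ∘ₗ LinearMap.inr k X Y) := by
      refine LinearMap.ext fun z => ?_
      simp only [LinearMap.add_apply, LinearMap.dualMap_apply, LinearMap.comp_apply,
        LinearMap.inl_apply, LinearMap.inr_apply, LinearMap.fst_apply, LinearMap.snd_apply]
      rw [← map_add]
      simp
    have h4 : φ f = φ ((LinearMap.fst k X Y).dualMap (f ∘ₗ LinearMap.inl k X Y)) +
        φ ((LinearMap.snd k X Y).dualMap (f ∘ₗ LinearMap.inr k X Y)) := by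
      rw [← map_add, ← h3]
    rw [h4]
    refine (congrArg₂ (· + ·) h1 h2).trans ?_
    simp only [LinearMap.comp_apply, LinearMap.inl_apply, LinearMap.inr_apply]
    rw [← map_add]
    simp

theorem IsPseudocompactMod.pi {ι : Type} [Finite ι] (hX : IsPseudocompactMod k A X) :
    IsPseudocompactMod k A (ι → X) := by
  have := hX.t2
  have := hX.addGroup
  have := hX.contSMul
  have := Fintype.ofFinite ι
  have hb : ∀ s ∈ nhds (0 : ι → X), ∃ V : Submodule A (ι → X), IsOpen (V : Set (ι → X)) ∧
      FiniteDimensional k ((ι → X) ⧸ V.restrictScalars k) ∧ (V : Set (ι → X)) ⊆ s := by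
    intro s hs
    rw [nhds_pi, Filter.mem_pi'] at hs
    obtain ⟨I, t, ht, hts⟩ := hs
    choose V hV hVf hVt using fun i => hX.exists_submodule (ht i)
    refine ⟨Submodule.pi Set.univ V, isOpen_set_pi Set.finite_univ fun i _ => hV i,
      finiteDimensional_quotient_of_ker_le
      (LinearMap.pi fun i => ((V i).restrictScalars k).mkQ ∘ₗ LinearMap.proj i) ?_,
      fun x hx => hts fun i _ => hVt i (hx i trivial)⟩
    intro x hx i _
    have := congrFun (LinearMap.mem_ker.1 hx) i
    simpa using this
  refine isPseudocompactMod_of_eval ⟨inferInstance, inferInstance, fun s hs => ?_⟩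
    (fun φ => ?_) inferInstance hb
  · obtain ⟨V, h⟩ := hb s hs
    exact ⟨V.restrictScalars k, h⟩
  · choose x hx using fun i : ι => hX.exists_eval (φ ∘ₗ (LinearMap.proj (R := k)
      (φ := fun _ : ι => X) i).dualMap)
    refine ⟨x, fun f hf => ?_⟩
    have h1 := fun i => hx i (f ∘ₗ LinearMap.single k (fun _ : ι => X) i)
      (hf.preimage (f := LinearMap.single k (fun _ : ι => X) i)
        (continuous_single (A := fun _ : ι => X) i))
    have h3 : f = ∑ i, (LinearMap.proj (R := k) (φ := fun _ : ι => X) i).dualMap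
        (f ∘ₗ LinearMap.single k (fun _ : ι => X) i) := by
      refine LinearMap.ext fun y => ?_
      conv_lhs => rw [← Finset.univ_sum_single y]
      simp [LinearMap.dualMap_apply]
    have h4 : φ f = ∑ i, φ ((LinearMap.proj (R := k) (φ := fun _ : ι => X) i).dualMap
        (f ∘ₗ LinearMap.single k (fun _ : ι => X) i)) := by
      rw [← map_sum, ← h3]
    rw [h4]
    refine (Finset.sum_congr rfl fun i _ => h1 i).trans ?_
    simp only [LinearMap.comp_apply, LinearMap.single_apply]
    rw [← map_sum, Finset.univ_sum_single]

end Reflexive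

section Levels

variable {k G}

variable (k) in
/-- The projection `k⟦G⟧ → k[G/N]` as an algebra homomorphism. -/
def projHom (N : OpenNormalSubgroup G) : CGA k G →ₐ[k] MonoidAlgebra k (G ⧸ N.toSubgroup) :=
  (Pi.evalAlgHom k (fun N : OpenNormalSubgroup G => MonoidAlgebra k (G ⧸ N.toSubgroup)) N).comp
    (CGA k G).val

theorem projHom_apply (N : OpenNormalSubgroup G) (a : CGA k G) : projHom k N a = a.1 N := rfl

theorem projHom_eq_zero_of_le {N M : OpenNormalSubgroup G} (h : N ≤ M) {a : CGA k G}
    (ha : projHom k N a = 0) : projHom k M a = 0 := by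
  rw [projHom_apply] at ha ⊢
  rw [← a.2 N M h, ha, map_zero]

theorem projHom_ofG (N : OpenNormalSubgroup G) (g : G) :
    projHom k N (ofG k G g) = MonoidAlgebra.single (g : G ⧸ N.toSubgroup) 1 := rfl

theorem exists_projHom_ne_zero {a : CGA k G} (ha : a ≠ 0) : ∃ N, projHom k N a ≠ 0 := by
  by_contra! h
  exact ha (Subtype.ext (funext h))

instance {X : Type} : DiscreteTopology (MonoidAlgebra k X) := ⟨rfl⟩

instance : IsTopologicalRing (CGA k G) :=
  inferInstanceAs (IsTopologicalRing (CGA k G).toSubring)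

instance : T2Space (CGA k G) := inferInstanceAs (T2Space (Subtype _))

theorem continuous_projHom (N : OpenNormalSubgroup G) : Continuous (projHom k N) :=
  (continuous_apply N).comp continuous_subtype_val

variable (k) in
/-- The kernel of `k⟦G⟧ → k[G/N]` as a left ideal. -/
def levelIdeal (N : OpenNormalSubgroup G) : Submodule (CGA k G) (CGA k G) :=
  RingHom.ker (projHom k N)

theorem mem_levelIdeal {N : OpenNormalSubgroup G} {a : CGA k G} :
    a ∈ levelIdeal k N ↔ projHom k N a = 0 := RingHom.mem_ker

theorem isOpen_levelIdeal (N : OpenNormalSubgroup G) :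
    IsOpen (levelIdeal k N : Set (CGA k G)) :=
  (isOpen_discrete {(0 : MonoidAlgebra k (G ⧸ N.toSubgroup))}).preimage (continuous_projHom N)

theorem exists_openNormalSubgroup_le [IsTopologicalGroup G] (s : Set (OpenNormalSubgroup G))
    (hs : s.Finite) :
    ∃ N : OpenNormalSubgroup G, ∀ M ∈ s, N ≤ M := by
  have : Nonempty (OpenNormalSubgroup G) :=
    ⟨{ toSubgroup := ⊤, isOpen' := isOpen_univ }⟩
  exact hs.bddBelow

theorem exists_levelIdeal_subset [IsTopologicalGroup G] {s : Set (CGA k G)}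
    (hs : s ∈ nhds (0 : CGA k G)) :
    ∃ N : OpenNormalSubgroup G, (levelIdeal k N : Set (CGA k G)) ⊆ s := by
  rw [mem_nhds_subtype] at hs
  obtain ⟨u, hu, hus⟩ := hs
  rw [nhds_pi, Filter.mem_pi] at hu
  obtain ⟨I, hI, t, ht, htu⟩ := hu
  obtain ⟨N, hN⟩ := exists_openNormalSubgroup_le I hI
  refine ⟨N, fun a ha => hus (htu fun M hM => ?_)⟩
  have h0 : a.1 M = 0 := projHom_eq_zero_of_le (hN M hM) (mem_levelIdeal.1 ha)
  rw [h0]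
  exact mem_of_mem_nhds (ht M)

variable [IsTopologicalGroup G] [CompactSpace G]

instance (N : OpenNormalSubgroup G) : Finite (G ⧸ N.toSubgroup) :=
  Subgroup.quotient_finite_of_isOpen N.toSubgroup N.isOpen'

instance (N : OpenNormalSubgroup G) : Fintype (G ⧸ N.toSubgroup) := Fintype.ofFinite _

instance (N : OpenNormalSubgroup G) :
    FiniteDimensional k (MonoidAlgebra k (G ⧸ N.toSubgroup)) :=
  Module.Finite.equiv (MonoidAlgebra.coeffLinearEquiv (M := G ⧸ N.toSubgroup) (S := k) k).symm

theorem finiteDimensional_quotient_levelIdeal (N : OpenNormalSubgroup G) :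
    FiniteDimensional k (CGA k G ⧸ (levelIdeal k N).restrictScalars k) :=
  finiteDimensional_quotient_of_ker_le (projHom k N).toLinearMap le_rfl

theorem isPseudocompactMod_self : IsPseudocompactMod k (CGA k G) (CGA k G) := by
  have hb : ∀ s ∈ nhds (0 : CGA k G), ∃ V : Submodule (CGA k G) (CGA k G),
      IsOpen (V : Set (CGA k G)) ∧
      FiniteDimensional k (CGA k G ⧸ V.restrictScalars k) ∧ (V : Set (CGA k G)) ⊆ s := by
    intro s hs
    obtain ⟨N, hN⟩ := exists_levelIdeal_subset hs
    exact ⟨levelIdeal k N, isOpen_levelIdeal N, finiteDimensional_quotient_levelIdeal N, hN⟩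
  refine isPseudocompactMod_of_eval ⟨inferInstance, inferInstance, fun s hs => ?_⟩
    (fun φ => ?_) inferInstance hb
  · obtain ⟨V, h⟩ := hb s hs
    exact ⟨V.restrictScalars k, h⟩
  · have hc : ∀ N : OpenNormalSubgroup G, ∃ c : MonoidAlgebra k (G ⧸ N.toSubgroup),
        ∀ μ : Module.Dual k (MonoidAlgebra k (G ⧸ N.toSubgroup)),
        μ c = φ (μ ∘ₗ (projHom k N).toLinearMap) := by
      intro N
      obtain ⟨c, hc⟩ := (Module.evalEquiv k (MonoidAlgebra k (G ⧸ N.toSubgroup))).surjective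
        (φ ∘ₗ (projHom k N).toLinearMap.dualMap)
      exact ⟨c, fun μ => LinearMap.congr_fun hc μ⟩
    choose c hc using hc
    refine ⟨⟨c, fun N M h => ?_⟩, fun f hf => ?_⟩
    · rw [← sub_eq_zero, ← Module.forall_dual_apply_eq_zero_iff k]
      intro ν
      rw [map_sub, hc M, sub_eq_zero]
      have h1 := hc N (ν ∘ₗ (tHom k G N M h).toLinearMap)
      refine h1.trans (congrArg φ ?_)
      ext a
      simp only [LinearMap.comp_apply, AlgHom.toLinearMap_apply, projHom_apply]
      rw [a.2 N M h]
    · obtain ⟨N, hN⟩ := exists_levelIdeal_subset (hf.mem_nhds (LinearMap.ker f).zero_mem)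
      have hmem : f ∈ (LinearMap.ker (projHom k N).toLinearMap).dualAnnihilator := by
        rw [Submodule.mem_dualAnnihilator]
        exact fun a ha => hN ha
      rw [← LinearMap.range_dualMap_eq_dualAnnihilator_ker] at hmem
      obtain ⟨μ, rfl⟩ := hmem
      exact (hc N μ).symm

theorem projHom_eq_sum (N : OpenNormalSubgroup G) (a : CGA k G) :
    projHom k N a = ∑ q : G ⧸ N.toSubgroup, MonoidAlgebra.single q ((projHom k N a).coeff q) := by
  conv_lhs => rw [← MonoidAlgebra.sum_coeff_single (projHom k N a)]
  rw [Finsupp.sum_fintype _ _ (by simp)]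

theorem sub_sum_mem_levelIdeal (N : OpenNormalSubgroup G) (a : CGA k G) :
    a - ∑ q : G ⧸ N.toSubgroup, (projHom k N a).coeff q • ofG k G q.out ∈ levelIdeal k N := by
  rw [mem_levelIdeal, map_sub, map_sum, sub_eq_zero, projHom_eq_sum]
  refine Finset.sum_congr rfl fun q _ => ?_
  rw [map_smul, projHom_ofG, QuotientGroup.out_eq', MonoidAlgebra.smul_single, smul_eq_mul,
    mul_one, ← projHom_eq_sum]

section Modules

variable {X Y : Type} [AddCommGroup X] [Module k X] [Module (CGA k G) X]
  [IsScalarTower k (CGA k G) X] [AddCommGroup Y] [Module k Y] [Module (CGA k G) Y]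
  [IsScalarTower k (CGA k G) Y]

theorem smul_sub_sum_smul (N : OpenNormalSubgroup G) (a : CGA k G) (x : X) :
    a • x = (a - ∑ q : G ⧸ N.toSubgroup, (projHom k N a).coeff q • ofG k G q.out) • x +
      ∑ q : G ⧸ N.toSubgroup, (projHom k N a).coeff q • ofG k G q.out • x := by
  rw [sub_smul, Finset.sum_smul]
  simp only [smul_assoc, sub_add_cancel]

theorem smul_mem_of_ofG_smul_mem (N : OpenNormalSubgroup G) (W : Submodule k X) {x : X}
    (hN : ∀ a ∈ levelIdeal k N, a • x ∈ W) (hx : ∀ g, ofG k G g • x ∈ W) (a : CGA k G) :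
    a • x ∈ W := by
  rw [smul_sub_sum_smul N]
  exact W.add_mem (hN _ (sub_sum_mem_levelIdeal N a))
    (W.sum_mem fun q _ => W.smul_mem _ (hx _))

/-- A `k`-linear `G`-equivariant map which is compatible with some level is linear over the
completed group algebra. -/
def equivariantLinearMap (f : X →ₗ[k] Y) (N : OpenNormalSubgroup G)
    (hX : ∀ a ∈ levelIdeal k N, ∀ x, f (a • x) = 0)
    (hY : ∀ a ∈ levelIdeal k N, ∀ x, a • f x = 0)
    (hf : ∀ g x, f (ofG k G g • x) = ofG k G g • f x) : X →ₗ[CGA k G] Y where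
  toFun := f
  map_add' := f.map_add
  map_smul' a x := by
    rw [RingHom.id_apply, smul_sub_sum_smul N a x, smul_sub_sum_smul N a (f x), map_add,
      hX _ (sub_sum_mem_levelIdeal N a), hY _ (sub_sum_mem_levelIdeal N a), map_sum]
    simp only [map_smul, hf]

theorem IsPseudocompactMod.exists_level [TopologicalSpace X]
    (hX : IsPseudocompactMod k (CGA k G) X) {s : Set X} (hs : s ∈ nhds (0 : X)) :
    ∃ N : OpenNormalSubgroup G, ∀ a ∈ levelIdeal k N, ∀ x : X, a • x ∈ s := by
  obtain ⟨V, hV, hVf, hVs⟩ := hX.exists_submodule hs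
  have := hX.contSMul
  have := hX.addGroup
  obtain ⟨S, hS⟩ := Module.Finite.fg_top (R := k) (M := X ⧸ V.restrictScalars k)
  have h1 : ∀ z : X ⧸ V.restrictScalars k,
      ∃ N : OpenNormalSubgroup G, ∀ a ∈ levelIdeal k N, a • z.out ∈ V := by
    intro z
    have hc : Continuous fun a : CGA k G => a • z.out := by fun_prop
    obtain ⟨N, hN⟩ := exists_levelIdeal_subset (hc.continuousAt.preimage_mem_nhds
      (hV.mem_nhds (by simp)))
    exact ⟨N, fun a ha => hN ha⟩
  choose n hn using h1
  obtain ⟨N, hN⟩ := exists_openNormalSubgroup_le (n '' S) (S.finite_toSet.image n)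
  refine ⟨N, fun a ha x => hVs ?_⟩
  let T : Submodule k X := (V.restrictScalars k).comap (Algebra.lsmul k k X a)
  have hVT : V.restrictScalars k ≤ T := fun v hv => V.smul_mem a hv
  have hT : T.map (V.restrictScalars k).mkQ = ⊤ := by
    rw [eq_top_iff, ← hS, Submodule.span_le]
    intro z hz
    refine ⟨z.out, ?_, Quotient.out_eq' z⟩
    exact hn z a (projHom_eq_zero_of_le (hN _ ⟨z, hz, rfl⟩) ha)
  have : x ∈ T := by
    have hx : (V.restrictScalars k).mkQ x ∈ T.map (V.restrictScalars k).mkQ := by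
      rw [hT]; trivial
    obtain ⟨y, hy, hyx⟩ := hx
    have hsub : x - y ∈ V.restrictScalars k := (Submodule.Quotient.eq _).1 hyx.symm
    simpa using T.add_mem (hVT hsub) hy
  exact this

/-- Discrete finite-dimensional modules inflated from a finite level are pseudocompact. -/
theorem isPseudocompactMod_of_discrete [TopologicalSpace X] [DiscreteTopology X]
    [FiniteDimensional k X] (N : OpenNormalSubgroup G)
    (hN : ∀ a ∈ levelIdeal k N, ∀ x : X, a • x = 0) : IsPseudocompactMod k (CGA k G) X := by
  have hb : ∀ s ∈ nhds (0 : X), ∃ V : Submodule (CGA k G) X, IsOpen (V : Set X) ∧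
      FiniteDimensional k (X ⧸ V.restrictScalars k) ∧ (V : Set X) ⊆ s := by
    intro s hs
    exact ⟨⊥, isOpen_discrete _, inferInstance, by simpa using mem_of_mem_nhds hs⟩
  refine isPseudocompactMod_of_eval ⟨inferInstance, inferInstance, fun s hs => ?_⟩
    (fun φ => ?_) ⟨?_⟩ hb
  · obtain ⟨V, h⟩ := hb s hs
    exact ⟨V.restrictScalars k, h⟩
  · obtain ⟨x, rfl⟩ := (Module.evalEquiv k X).surjective φ
    exact ⟨x, fun f _ => rfl⟩
  · rw [continuous_iff_continuousAt]
    rintro ⟨a, x⟩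
    rw [ContinuousAt, nhds_discrete X, Filter.tendsto_pure, nhds_prod_eq, nhds_discrete X,
      Filter.eventually_prod_iff]
    refine ⟨fun b => b - a ∈ levelIdeal k N, ?_, fun y => y = x, by simp, ?_⟩
    · have hc : Continuous fun b : CGA k G => b - a := by fun_prop
      exact hc.continuousAt.preimage_mem_nhds ((isOpen_levelIdeal N).mem_nhds (by simp))
    · rintro b hb y rfl
      have := hN _ hb y
      rwa [sub_smul, sub_eq_zero] at this

end Modules

end Levels

section DualBasis

variable {k G} [IsTopologicalGroup G] [CompactSpace G]
  {Q : Type} [AddCommGroup Q] [Module k Q] [Module (CGA k G) Q]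
  [IsScalarTower k (CGA k G) Q] [TopologicalSpace Q]

/-- A topological module with an approximate dual basis modulo every open submodule. -/
def HasDualBases (Q : Type) [AddCommGroup Q] [Module (CGA k G) Q] [TopologicalSpace Q]
    (V : Submodule (CGA k G) Q) : Prop :=
  ∃ (ι : Type) (_ : Fintype ι) (v : ι → Q) (l : ι → Q →ₗ[CGA k G] CGA k G),
    (∀ i, Continuous (l i)) ∧ ∀ x, x - ∑ i, l i x • v i ∈ V

theorem IsPCProjective.hasDualBases (hproj : IsPCProjective k G Q)
    (hQ : IsPseudocompactMod k (CGA k G) Q) {V : Submodule (CGA k G) Q}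
    (hV : IsOpen (V : Set Q)) [hVf : FiniteDimensional k (Q ⧸ V.restrictScalars k)] :
    HasDualBases Q V := by
  have := hQ.addGroup
  have := hQ.contSMul
  obtain ⟨S, hS⟩ := Module.Finite.fg_top (R := k) (M := Q ⧸ V.restrictScalars k)
  let v : S → Q := fun z => z.1.out
  let f : ((S → CGA k G) × V) →ₗ[CGA k G] Q :=
    (Fintype.linearCombination (CGA k G) v).coprod V.subtype
  have hf : ∀ a w, f (a, w) = ∑ i, a i • v i + (w : Q) := fun a w => rfl
  have hc : Continuous f := by
    have : Continuous fun z : (S → CGA k G) × V => ∑ i, z.1 i • v i + (z.2 : Q) := by fun_prop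
    exact this
  have hs : Function.Surjective f := by
    let T : Submodule k Q := (LinearMap.range f).restrictScalars k
    have hVT : V.restrictScalars k ≤ T := fun w hw => ⟨(0, ⟨w, hw⟩), by
      rw [hf]
      simp⟩
    have hT : T.map (V.restrictScalars k).mkQ = ⊤ := by
      rw [eq_top_iff, ← hS, Submodule.span_le]
      intro z hz
      exact ⟨z.out, ⟨(Pi.single ⟨z, hz⟩ 1, 0), by
        rw [hf, Finset.sum_eq_single ⟨z, hz⟩ (fun b _ hb => by simp [hb]) (by simp)]
        simp [v]⟩, Quotient.out_eq' z⟩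
    intro x
    have hx : (V.restrictScalars k).mkQ x ∈ T.map (V.restrictScalars k).mkQ := by
      rw [hT]; trivial
    obtain ⟨y, hy, hyx⟩ := hx
    have hsub : x - y ∈ V.restrictScalars k := (Submodule.Quotient.eq _).1 hyx.symm
    have h1 : x ∈ T := by simpa using T.add_mem (hVT hsub) hy
    exact h1
  obtain ⟨s, hsc, hfs⟩ := hproj _ ((isPseudocompactMod_self.pi (ι := S)).prod
    (hQ.of_isClosed (isClosed_of_submodule_isOpen hV))) f hc hs
  refine ⟨S, inferInstance, v, fun i => LinearMap.proj i ∘ₗ LinearMap.fst (CGA k G) (S → CGA k G) V ∘ₗ s,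
    fun i => (continuous_apply i).comp (continuous_fst.comp hsc), fun x => ?_⟩
  have h1 : f ((s x).1, (s x).2) = x := LinearMap.congr_fun hfs x
  rw [hf] at h1
  have h2 : x - ∑ i, (s x).1 i • v i = (s x).2 := by
    rw [sub_eq_iff_eq_add, add_comm]
    exact h1.symm
  have h3 := (s x).2.2
  rw [← h2] at h3
  exact h3

end DualBasis

section ZpGroup

variable {G} {p : ℕ} [Fact p.Prime]

/-- A topological generator of a copy of `ℤ_p`. -/
structure IsZpGenerator (p : ℕ) (D : Subgroup G) (d : G) : Prop where
  mem : d ∈ D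
  le_sup : ∀ N : OpenNormalSubgroup G, D ≤ Subgroup.zpowers d ⊔ N.toSubgroup
  pow_mem : ∀ N : OpenNormalSubgroup G, ∃ n : ℕ, d ^ p ^ n ∈ N.toSubgroup
  pow_ne : ∀ m : ℕ, m ≠ 0 → d ^ m ≠ 1

theorem IsZpGroup.exists_generator [IsTopologicalGroup G] {D : Subgroup G}
    (h : IsZpGroup G p D) : ∃ d, IsZpGenerator p D d := by
  obtain ⟨φ, hφ⟩ := h
  let ψ : D ≃* Multiplicative ℤ_[p] := { φ.toEquiv with map_mul' := hφ }
  let d : D := ψ.symm (Multiplicative.ofAdd 1)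
  have hd : ∀ z : ℤ, d ^ z = ψ.symm (Multiplicative.ofAdd (z : ℤ_[p])) := by
    intro z
    rw [← map_zpow, ← ofAdd_zsmul, zsmul_one]
  have hψ : Continuous fun z : ℤ_[p] => ((ψ.symm (Multiplicative.ofAdd z) : D) : G) :=
    continuous_subtype_val.comp (φ.symm.continuous.comp continuous_ofAdd)
  refine ⟨d, d.2, fun N x hx => ?_, fun N => ?_, fun m hm h1 => ?_⟩
  · have hdense := PadicInt.denseRange_intCast (p := p)
    have hopen : IsOpen {z : ℤ_[p] |
        ((ψ.symm (Multiplicative.ofAdd z) : D) : G)⁻¹ * x ∈ (N : Set G)} :=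
      (show IsOpen (N : Set G) from N.isOpen').preimage (by fun_prop)
    obtain ⟨_, hz, z, rfl⟩ := hdense.inter_open_nonempty _ hopen
      ⟨Multiplicative.toAdd (ψ ⟨x, hx⟩), by
        have : (ψ.symm (Multiplicative.ofAdd (Multiplicative.toAdd (ψ ⟨x, hx⟩))) : D) =
          ⟨x, hx⟩ := by simp
        rw [Set.mem_ofPred_eq, this]
        simp⟩
    rw [Set.mem_ofPred_eq, ← hd z] at hz
    have : x = (d : G) ^ z * (((d : G) ^ z)⁻¹ * x) := by group
    rw [this]
    exact Subgroup.mul_mem_sup (Subgroup.zpow_mem_zpowers _ _) hz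
  · have ht : Filter.Tendsto (fun n : ℕ => (p : ℤ_[p]) ^ n) Filter.atTop (nhds 0) := by
      apply tendsto_pow_atTop_nhds_zero_of_norm_lt_one
      rw [PadicInt.norm_p]
      exact inv_lt_one_of_one_lt₀ (by exact_mod_cast (Fact.out : p.Prime).one_lt)
    have h2 := (hψ.tendsto 0).comp ht
    have h3 : ((ψ.symm (Multiplicative.ofAdd (0 : ℤ_[p])) : D) : G) = 1 := by simp
    rw [h3] at h2
    obtain ⟨n, hn⟩ := (h2.eventually ((show IsOpen (N : Set G) from N.isOpen').mem_nhds
      N.toSubgroup.one_mem)).exists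
    refine ⟨n, ?_⟩
    have h4 := hd ((p ^ n : ℕ) : ℤ)
    have h5 : ((d ^ (p ^ n) : D) : G) ∈ N.toSubgroup := by
      rw [zpow_natCast] at h4
      rw [h4]
      exact_mod_cast hn
    simpa using h5
  · have h2 : d ^ (m : ℤ) = 1 := by
      rw [zpow_natCast]
      exact Subtype.ext (by simpa using h1)
    rw [hd, MulEquiv.map_eq_one_iff] at h2
    have h3 : ((m : ℤ) : ℤ_[p]) = 0 := h2
    have h4 : (m : ℤ) = 0 := by exact_mod_cast h3
    exact hm (by exact_mod_cast h4)

end ZpGroup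

theorem exists_shift {K H : Type*} [Ring K] [Group H] {p : ℕ} [CharP K p] (δ : H)
    (h : p ∣ orderOf δ) : ∃ u : H → K, ∀ q, u (δ * q) = u q + 1 := by
  choose j hj using fun q : H => QuotientGroup.mk_out_eq_mul (Subgroup.zpowers δ) q⁻¹
  choose z hz using fun q : H => Subgroup.mem_zpowers_iff.1 (j q).2
  refine ⟨fun q => (z q : K), fun q => ?_⟩
  have h1 : (((δ * q)⁻¹ : H) : H ⧸ Subgroup.zpowers δ) = ((q⁻¹ : H) : H ⧸ Subgroup.zpowers δ) :=
    QuotientGroup.eq.2 (by simp)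
  have h2 := hj (δ * q)
  rw [h1, hj q, ← hz, ← hz, mul_inv_rev, mul_assoc, mul_right_inj] at h2
  have h3 : δ ^ (z (δ * q) - (z q + 1)) = 1 := by
    rw [zpow_sub, mul_inv_eq_one, zpow_add_one, h2]
    group
  have h4 : (p : ℤ) ∣ z (δ * q) - (z q + 1) :=
    (Int.natCast_dvd_natCast.2 h).trans (orderOf_dvd_iff_zpow_eq_one.2 h3)
  have h5 := (CharP.intCast_eq_zero_iff K p _).2 h4
  push_cast at h5
  exact sub_eq_zero.1 h5

section Conjugation

variable {k G} {Q X : Type} [AddCommGroup Q] [Module k Q] [Module (CGA k G) Q]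
  [IsScalarTower k (CGA k G) Q] [AddCommGroup X] [Module k X] [Module (CGA k G) X]
  [IsScalarTower k (CGA k G) X]

/-- The action of a group element on a `k⟦G⟧`-module. -/
def actHom (X : Type) [AddCommGroup X] [Module k X] [Module (CGA k G) X]
    [IsScalarTower k (CGA k G) X] : G →* Module.End k X :=
  ((Algebra.lsmul k k X : CGA k G →ₐ[k] Module.End k X) : CGA k G →* Module.End k X).comp
    (ofG k G)

/-- The conjugation action of a group element on the linear maps between two
`k⟦G⟧`-modules. -/
def conjHom (Q X : Type) [AddCommGroup Q] [Module k Q] [Module (CGA k G) Q]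
    [IsScalarTower k (CGA k G) Q] [AddCommGroup X] [Module k X] [Module (CGA k G) X]
    [IsScalarTower k (CGA k G) X] : G →* Module.End k (Q →ₗ[k] X) where
  toFun g :=
    { toFun := fun b => actHom X g ∘ₗ b ∘ₗ actHom Q g⁻¹
      map_add' := fun b b' => by rw [LinearMap.add_comp, LinearMap.comp_add]
      map_smul' := fun c b => by rw [LinearMap.smul_comp, LinearMap.comp_smul]; rfl }
  map_one' := by
    ext b x
    simp
  map_mul' g h := by
    ext b x
    simp

theorem conjHom_apply (g : G) (b : Q →ₗ[k] X) (x : Q) :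
    conjHom Q X g b x = ofG k G g • b (ofG k G g⁻¹ • x) := rfl

theorem isOpen_ker_conjHom [TopologicalSpace Q] [ContinuousConstSMul (CGA k G) Q]
    [IsTopologicalAddGroup Q] (g : G) {b : Q →ₗ[k] X} (hb : IsOpen (LinearMap.ker b : Set Q)) :
    IsOpen (LinearMap.ker (conjHom Q X g b) : Set Q) := by
  have h1 : IsOpen ((LinearMap.ker b).comap (actHom (k := k) Q g⁻¹) : Set Q) :=
    hb.preimage (continuous_const_smul (ofG k G g⁻¹))
  refine isOpen_of_submodule_le (fun x hx => ?_) h1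
  have hx' : b (ofG k G g⁻¹ • x) = 0 := hx
  rw [LinearMap.mem_ker, conjHom_apply, hx', smul_zero]

theorem isOpen_ker_conjHom_sub_one_pow [TopologicalSpace Q] [ContinuousConstSMul (CGA k G) Q]
    [IsTopologicalAddGroup Q] (g : G) {b : Q →ₗ[k] X} (hb : IsOpen (LinearMap.ker b : Set Q))
    (n : ℕ) : IsOpen (LinearMap.ker (((conjHom Q X g - 1) ^ n) b) : Set Q) := by
  induction n with
  | zero => simpa using hb
  | succ n ih =>
    rw [pow_succ', Module.End.mul_apply]
    set b' := ((conjHom Q X g - 1) ^ n) b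
    refine isOpen_of_submodule_le (V := LinearMap.ker (conjHom Q X g b') ⊓ LinearMap.ker b')
      (fun x hx => ?_) ((isOpen_ker_conjHom g ih).inter ih)
    have h1 : conjHom Q X g b' x = 0 := hx.1
    have h2 : b' x = 0 := hx.2
    rw [LinearMap.mem_ker, LinearMap.sub_apply, LinearMap.sub_apply, h1, Module.End.one_apply, h2,
      sub_zero]

/-- The coefficient of an element of `k⟦G⟧` at a point of a finite quotient of `G`. -/
def coeffAt (N : OpenNormalSubgroup G) (q : G ⧸ N.toSubgroup) : CGA k G →ₗ[k] k :=
  Finsupp.lapply q ∘ₗ (MonoidAlgebra.coeffLinearEquiv (M := G ⧸ N.toSubgroup) (S := k) k) ∘ₗ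
    (projHom k N).toLinearMap

theorem coeffAt_apply (N : OpenNormalSubgroup G) (q : G ⧸ N.toSubgroup) (a : CGA k G) :
    coeffAt N q a = (projHom k N a).coeff q := rfl

theorem coeffAt_eq_zero {N : OpenNormalSubgroup G} (q : G ⧸ N.toSubgroup) {a : CGA k G}
    (ha : a ∈ levelIdeal k N) : coeffAt N q a = 0 := by
  rw [coeffAt_apply, mem_levelIdeal.1 ha]
  rfl

theorem coeffAt_ofG_mul (N : OpenNormalSubgroup G) (q : G ⧸ N.toSubgroup) (g : G) (a : CGA k G) :
    coeffAt N q (ofG k G g * a) = coeffAt N ((g : G ⧸ N.toSubgroup)⁻¹ * q) a := by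
  rw [coeffAt_apply, map_mul, projHom_ofG, MonoidAlgebra.coeff_single_mul_apply, one_mul]
  rfl

theorem levelIdeal_mono {N M : OpenNormalSubgroup G} (h : N ≤ M) :
    levelIdeal k N ≤ levelIdeal k M := fun _ ha =>
  mem_levelIdeal.2 (projHom_eq_zero_of_le h (mem_levelIdeal.1 ha))

theorem ofG_sub_ofG_mem {N : OpenNormalSubgroup G} {g h : G}
    (hgh : (g : G ⧸ N.toSubgroup) = h) : ofG k G g - ofG k G h ∈ levelIdeal k N := by
  rw [mem_levelIdeal, map_sub, projHom_ofG, projHom_ofG, hgh, sub_self]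

end Conjugation

section ShiftSolve

variable {k G} [IsTopologicalGroup G] [CompactSpace G] [TotallyDisconnectedSpace G] [T2Space G]
  {p : ℕ} [Fact p.Prime] [CharP k p]
  {Q X : Type} [AddCommGroup Q] [Module k Q] [Module (CGA k G) Q]
  [IsScalarTower k (CGA k G) Q] [AddCommGroup X] [Module k X] [Module (CGA k G) X]
  [IsScalarTower k (CGA k G) X] [TopologicalSpace Q]

theorem exists_openNormalSubgroup_notMem {g : G} (hg : g ≠ 1) :
    ∃ N : OpenNormalSubgroup G, g ∉ N.toSubgroup := by
  obtain ⟨H, hH⟩ := ProfiniteGrp.exist_openNormalSubgroup_sub_open_nhds_of_one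
    (isOpen_compl_singleton (x := g)) (Set.mem_compl_singleton_iff.2 hg.symm)
  exact ⟨H, fun h => hH h rfl⟩

theorem sub_one_pow_prime_pow {M : Type} [AddCommGroup M] [Module k M] (T : Module.End k M)
    (n : ℕ) : (T - 1) ^ p ^ n = T ^ p ^ n - 1 := by
  have h : (Polynomial.X - 1 : Polynomial k) ^ p ^ n = Polynomial.X ^ p ^ n - 1 := by
    rw [sub_pow_char_pow, one_pow]
  simpa using congrArg (Polynomial.aeval T) h

/-- If `g` generates a copy of `ℤ_p` topologically, then `g - 1` acts surjectively on the
continuous linear maps from a projective module to a module on which an open subgroup acts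
trivially. -/
theorem exists_conjHom_sub_eq (hQ : IsPseudocompactMod k (CGA k G) Q)
    (hproj : IsPCProjective k G Q) {N : OpenNormalSubgroup G}
    (hX : ∀ a ∈ levelIdeal k N, ∀ x : X, a • x = 0) {D : Subgroup G} {d : G}
    (hd : IsZpGenerator p D d) {C : Q →ₗ[k] X} (hC : IsOpen (LinearMap.ker C : Set Q)) :
    ∃ b : Q →ₗ[k] X, IsOpen (LinearMap.ker b : Set Q) ∧ conjHom Q X d b - b = C := by
  have := hQ.addGroup
  have := hQ.contSMul
  obtain ⟨V, hV, hVf, hVC⟩ := hQ.exists_submodule (hC.mem_nhds (LinearMap.ker C).zero_mem)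
  have hVC : ∀ x ∈ V, C x = 0 := fun x hx => hVC hx
  obtain ⟨N₁, hN₁⟩ := hQ.exists_level (hV.mem_nhds V.zero_mem)
  obtain ⟨M, hM⟩ := exists_openNormalSubgroup_le {N, N₁} (by simp)
  have hMN : M ≤ N := hM N (by simp)
  have hMN₁ : M ≤ N₁ := hM N₁ (by simp)
  obtain ⟨n, hn⟩ := hd.pow_mem M
  obtain ⟨M₂, hM₂⟩ := exists_openNormalSubgroup_notMem
    (hd.pow_ne (p ^ n) (pow_ne_zero _ (Fact.out : p.Prime).ne_zero))
  obtain ⟨M', hM'⟩ := exists_openNormalSubgroup_le {M, M₂} (by simp)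
  have hM'M : M' ≤ M := hM' M (by simp)
  have hM'M₂ : M' ≤ M₂ := hM' M₂ (by simp)
  set m := p ^ n with hm
  set δ : G ⧸ M'.toSubgroup := ((d ^ m : G) : G ⧸ M'.toSubgroup)⁻¹ with hδ
  have hδp : p ∣ orderOf δ := by
    rw [hδ, orderOf_inv]
    obtain ⟨n', hn'⟩ := hd.pow_mem M'
    have h1 : ((d : G) : G ⧸ M'.toSubgroup) ^ p ^ n' = 1 := by
      rw [← QuotientGroup.mk_pow]
      exact (QuotientGroup.eq_one_iff _).2 hn'
    have h2 : orderOf ((d ^ m : G) : G ⧸ M'.toSubgroup) ∣ p ^ n' := by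
      rw [orderOf_dvd_iff_pow_eq_one, QuotientGroup.mk_pow, pow_right_comm, h1, one_pow]
    obtain ⟨j, -, hj⟩ := (Nat.dvd_prime_pow Fact.out).1 h2
    rw [hj]
    refine dvd_pow_self p fun hj0 => ?_
    rw [hj0, pow_zero, orderOf_eq_one_iff, QuotientGroup.eq_one_iff] at hj
    exact hM₂ (hM'M₂ hj)
  obtain ⟨u, hu⟩ := exists_shift (K := k) δ hδp
  obtain ⟨ι, _, v, l, hlc, hl⟩ := hproj.hasDualBases hQ hV
  let F : (G ⧸ M'.toSubgroup → k) → Q →ₗ[k] X := fun w =>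
    ∑ i, ∑ q, w q • ((coeffAt M' q) ∘ₗ ((l i).restrictScalars k)).smulRight
      (C (ofG k G q.out • v i))
  have hF : ∀ w x, F w x = ∑ i, ∑ q, w q • coeffAt M' q (l i x) • C (ofG k G q.out • v i) := by
    intro w x
    simp [F]
  have hCN : ∀ a ∈ levelIdeal k N₁, ∀ x, C (a • x) = 0 := fun a ha x => hVC _ (hN₁ a ha x)
  have hCcongr : ∀ g h : G, (g : G ⧸ N₁.toSubgroup) = h →
      ∀ x, C (ofG k G g • x) = C (ofG k G h • x) := by
    intro g h hgh x
    rw [← sub_eq_zero, ← map_sub, ← sub_smul]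
    exact hCN _ (ofG_sub_ofG_mem hgh) x
  have hFker : IsOpen (LinearMap.ker (F u) : Set Q) := by
    refine isOpen_of_submodule_le
      (V := ((⨅ i, (levelIdeal k M').comap (l i)).restrictScalars k)) (fun x hx => ?_) ?_
    · rw [LinearMap.mem_ker, hF]
      have hx' := (Submodule.mem_iInf _).1 (show x ∈ ⨅ i, (levelIdeal k M').comap (l i) from hx)
      refine Finset.sum_eq_zero fun i _ => Finset.sum_eq_zero fun q _ => ?_
      rw [coeffAt_eq_zero q (hx' i), zero_smul, smul_zero]
    · have h1 : (((⨅ i, (levelIdeal k M').comap (l i)).restrictScalars k : Submodule k Q) : Set Q) =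
          ⋂ i, (l i) ⁻¹' (levelIdeal k M' : Set (CGA k G)) := by
        ext x
        simp
      rw [h1]
      exact isOpen_iInter_of_finite fun i => (isOpen_levelIdeal M').preimage (hlc i)
  have hshift : ∀ x, F u (ofG k G (d ^ m)⁻¹ • x) - F u x = C x := by
    intro x
    have h1 : C x = ∑ i, ∑ q, coeffAt M' q (l i x) • C (ofG k G q.out • v i) := by
      have h2 := hVC _ (hl x)
      rw [map_sub, sub_eq_zero] at h2
      rw [h2, map_sum]
      refine Finset.sum_congr rfl fun i _ => ?_
      have h3 := hCN _ (levelIdeal_mono (hM'M.trans hMN₁) (sub_sum_mem_levelIdeal M' (l i x))) (v i)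
      rw [sub_smul, map_sub, sub_eq_zero] at h3
      rw [h3, Finset.sum_smul, map_sum]
      refine Finset.sum_congr rfl fun q _ => ?_
      rw [smul_assoc, map_smul]
      rfl
    have h4 : F u (ofG k G (d ^ m)⁻¹ • x) =
        ∑ i, ∑ q, u (δ * q) • coeffAt M' q (l i x) • C (ofG k G q.out • v i) := by
      rw [hF]
      refine Finset.sum_congr rfl fun i _ => ?_
      rw [← Equiv.sum_comp (Equiv.mulLeft δ)]
      refine Finset.sum_congr rfl fun q _ => ?_
      have h5 : coeffAt M' (δ * q) (l i (ofG k G (d ^ m)⁻¹ • x)) = coeffAt M' q (l i x) := by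
        rw [map_smul, smul_eq_mul, coeffAt_ofG_mul]
        congr 1
        rw [QuotientGroup.mk_inv, hδ]
        group
      have h6 : C (ofG k G (δ * q).out • v i) = C (ofG k G q.out • v i) := by
        apply hCcongr
        have h7 : qHom G M' N₁ (hM'M.trans hMN₁) δ = 1 := by
          rw [hδ, map_inv, inv_eq_one]
          exact (QuotientGroup.eq_one_iff _).2 (hMN₁ hn)
        have h8 : ∀ q : G ⧸ M'.toSubgroup, (q.out : G ⧸ N₁.toSubgroup) =
            qHom G M' N₁ (hM'M.trans hMN₁) q := by
          intro q
          conv_rhs => rw [← QuotientGroup.out_eq' q]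
          rfl
        rw [h8, h8, map_mul, h7, one_mul]
      rw [Equiv.coe_mulLeft, h5, h6]
    rw [h4, hF, h1, ← Finset.sum_sub_distrib]
    refine Finset.sum_congr rfl fun i _ => ?_
    rw [← Finset.sum_sub_distrib]
    refine Finset.sum_congr rfl fun q _ => ?_
    rw [hu, add_smul, one_smul, add_sub_cancel_left]
  have hpow : (conjHom Q X d ^ m) (F u) - F u = C := by
    ext x
    rw [← map_pow, LinearMap.sub_apply, conjHom_apply, ← hshift x]
    congr 1
    have h1 := hX _ (ofG_sub_ofG_mem (k := k) (N := N) (g := d ^ m) (h := 1)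
      ((QuotientGroup.eq_one_iff _).2 (hMN hn))) (F u (ofG k G (d ^ m)⁻¹ • x))
    rw [map_one, sub_smul, one_smul, sub_eq_zero] at h1
    exact h1
  refine ⟨((conjHom Q X d - 1) ^ (m - 1)) (F u), isOpen_ker_conjHom_sub_one_pow d hFker _, ?_⟩
  have h1 : ((conjHom Q X d - 1) ^ m) (F u) = C := by
    rw [hm, sub_one_pow_prime_pow, ← hm, ← hpow]
    rfl
  have h2 : m - 1 + 1 = m :=
    Nat.sub_add_cancel (Nat.one_le_iff_ne_zero.2 (pow_ne_zero _ (Fact.out : p.Prime).ne_zero))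
  rw [← h2, pow_succ', Module.End.mul_apply] at h1
  exact h1

/-- A projective module of a group with an element generating `ℤ_p` is not finite. -/
theorem IsPCProjective.subsingleton_of_isOpen_bot (hQ : IsPseudocompactMod k (CGA k G) Q)
    (hproj : IsPCProjective k G Q) (hbot : IsOpen ((⊥ : Submodule k Q) : Set Q))
    {D : Subgroup G} {d : G} (hd : IsZpGenerator p D d) : Subsingleton Q := by
  have hker : ∀ f : Q →ₗ[k] Q, IsOpen (LinearMap.ker f : Set Q) := by
    have := hQ.addGroup
    exact fun f => isOpen_of_submodule_le bot_le hbot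
  obtain ⟨V, -, hVf, hVs⟩ := hQ.exists_submodule (hbot.mem_nhds rfl)
  have hV : V.restrictScalars k = ⊥ := le_bot_iff.1 fun x hx => hVs hx
  rw [hV] at hVf
  have : FiniteDimensional k Q := Module.Finite.equiv (Submodule.quotEquivOfEqBot _ rfl)
  obtain ⟨N, hN⟩ := hQ.exists_level (hbot.mem_nhds rfl)
  have hsurj : Function.Surjective (conjHom Q Q d - 1 : Module.End k (Q →ₗ[k] Q)) := fun C => by
    obtain ⟨b, -, hb⟩ := exists_conjHom_sub_eq (X := Q) hQ hproj (N := N)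
      (fun a ha x => hN a ha x) hd (hker C)
    exact ⟨b, hb⟩
  have hinj := LinearMap.injective_iff_surjective.2 hsurj
  have h1 : (conjHom Q Q d - 1 : Module.End k (Q →ₗ[k] Q)) LinearMap.id = 0 := by
    ext x
    rw [LinearMap.sub_apply, LinearMap.sub_apply, conjHom_apply, Module.End.one_apply,
      LinearMap.id_apply, ← mul_smul, ← map_mul, mul_inv_cancel, map_one, one_smul]
    simp
  have h2 : (LinearMap.id : Q →ₗ[k] Q) = 0 := hinj (h1.trans (map_zero _).symm)
  exact ⟨fun x y => by
    have hx := LinearMap.congr_fun h2 x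
    have hy := LinearMap.congr_fun h2 y
    exact hx.trans hy.symm⟩

end ShiftSolve

theorem IsLinCpt.exists_factor {k X Y E : Type} [Field k] [AddCommGroup X] [Module k X]
    [TopologicalSpace X] [AddCommGroup Y] [Module k Y] [TopologicalSpace Y] [AddCommGroup E]
    [Module k E] (hX : IsLinCpt k X) (hY : IsLinCpt k Y) (f : X →ₗ[k] Y) (hf : Continuous f)
    (c : X →ₗ[k] E) (hc : IsOpen (LinearMap.ker c : Set X))
    (hfc : LinearMap.ker f ≤ LinearMap.ker c) :
    ∃ C : Y →ₗ[k] E, IsOpen (LinearMap.ker C : Set Y) ∧ ∀ x, C (f x) = c x := by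
  have hR : IsClosed (LinearMap.range f : Set Y) := by
    rw [← Submodule.map_top]
    exact hX.isClosed_map hY.toIsLinTop f hf isClosed_univ
  have hRc := hY.of_isClosed hR
  let C₀ : LinearMap.range f →ₗ[k] E :=
    (LinearMap.ker f).liftQ c hfc ∘ₗ f.quotKerEquivRange.symm.toLinearMap
  have hC₀ : ∀ x, C₀ ⟨f x, x, rfl⟩ = c x := by
    intro x
    have h1 : f.quotKerEquivRange.symm ⟨f x, x, rfl⟩ = (LinearMap.ker f).mkQ x := by
      rw [LinearEquiv.symm_apply_eq]
      rfl
    change (LinearMap.ker f).liftQ c hfc (f.quotKerEquivRange.symm ⟨f x, x, rfl⟩) = c x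
    rw [h1]
    rfl
  have hopen : IsOpen (LinearMap.ker C₀ : Set (LinearMap.range f)) := by
    have h1 := hX.isOpen_map hRc.toIsLinTop f.rangeRestrict (hf.subtype_mk _)
      f.surjective_rangeRestrict hc
    convert h1 using 2
    ext y
    constructor
    · obtain ⟨_, x, rfl⟩ := y
      intro hy
      exact ⟨x, (hC₀ x).symm.trans hy, rfl⟩
    · rintro ⟨x, hx, rfl⟩
      exact (hC₀ x).trans hx
  obtain ⟨C, hC, hCe⟩ := hY.toIsLinTop.exists_extend C₀ hopen
  exact ⟨C, hC, fun x => (hCe ⟨f x, x, rfl⟩).trans (hC₀ x)⟩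

section Averaging

variable {k G} [IsTopologicalGroup G] [CompactSpace G]
  {X Z : Type} [AddCommGroup X] [Module k X] [Module (CGA k G) X]
  [IsScalarTower k (CGA k G) X] [AddCommGroup Z] [Module k Z] [Module (CGA k G) Z]
  [IsScalarTower k (CGA k G) Z] [TopologicalSpace X]

theorem apply_smul_of_conjHom_eq {g : G} {f : X →ₗ[k] Z} (hf : conjHom X Z g f = f) (x : X) :
    f (ofG k G g • x) = ofG k G g • f x := by
  conv_lhs => rw [← hf, conjHom_apply, ← mul_smul, ← map_mul, inv_mul_cancel, map_one, one_smul]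

theorem conjHom_eq_of_apply_smul {g : G} {f : X →ₗ[k] Z}
    (hf : ∀ x, f (ofG k G g⁻¹ • x) = ofG k G g⁻¹ • f x) : conjHom X Z g f = f := by
  ext x
  rw [conjHom_apply, hf, ← mul_smul, ← map_mul, mul_inv_cancel, map_one, one_smul]

theorem exists_linearMap_of_conjHom_eq (hX : IsPseudocompactMod k (CGA k G) X)
    {N : OpenNormalSubgroup G} (hZ : ∀ a ∈ levelIdeal k N, ∀ z : Z, a • z = 0)
    {f : X →ₗ[k] Z} (hf : IsOpen (LinearMap.ker f : Set X)) (hfG : ∀ g : G, conjHom X Z g f = f) :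
    ∃ f' : X →ₗ[CGA k G] Z, ∀ x, f' x = f x := by
  obtain ⟨N₁, hN₁⟩ := hX.exists_level (hf.mem_nhds (LinearMap.ker f).zero_mem)
  obtain ⟨M, hM⟩ := exists_openNormalSubgroup_le {N, N₁} (by simp)
  exact ⟨equivariantLinearMap f M
    (fun a ha x => hN₁ a (levelIdeal_mono (hM N₁ (by simp)) ha) x)
    (fun a ha x => hZ a (levelIdeal_mono (hM N (by simp)) ha) _)
    (fun g x => apply_smul_of_conjHom_eq (hfG g) x), fun _ => rfl⟩

theorem isOpen_ker_sum {ι : Type} [IsTopologicalAddGroup X] (s : Finset ι) (f : ι → X →ₗ[k] Z)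
    (hf : ∀ i, IsOpen (LinearMap.ker (f i) : Set X)) :
    IsOpen (LinearMap.ker (∑ i ∈ s, f i) : Set X) := by
  refine isOpen_of_submodule_le (V := ⨅ i ∈ s, LinearMap.ker (f i)) (fun x hx => ?_) ?_
  · simp only [Submodule.mem_iInf] at hx
    rw [LinearMap.mem_ker, LinearMap.sum_apply]
    exact Finset.sum_eq_zero hx
  · have h1 : ((⨅ i ∈ s, LinearMap.ker (f i) : Submodule k X) : Set X) =
        ⋂ i ∈ s, (LinearMap.ker (f i) : Set X) := by
      ext x
      simp
    rw [h1]
    exact isOpen_biInter_finset fun i _ => hf i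

theorem conjHom_eq_of_mem_level {N : OpenNormalSubgroup G}
    (hZ : ∀ a ∈ levelIdeal k N, ∀ z : Z, a • z = 0) {f : X →ₗ[k] Z}
    (hf : ∀ a ∈ levelIdeal k N, ∀ x, f (a • x) = 0) {n : G} (hn : n ∈ N.toSubgroup) :
    conjHom X Z n f = f := by
  refine conjHom_eq_of_apply_smul fun x => ?_
  have h1 : ofG k G n⁻¹ - 1 ∈ levelIdeal k N := by
    have := ofG_sub_ofG_mem (k := k) (N := N) (g := n⁻¹) (h := 1)
      ((QuotientGroup.eq_one_iff _).2 (inv_mem hn))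
    rwa [map_one] at this
  have h2 := hf _ h1 x
  have h3 := hZ _ h1 (f x)
  rw [sub_smul, one_smul, map_sub, sub_eq_zero] at h2
  rw [sub_smul, one_smul, sub_eq_zero] at h3
  rw [h2, h3]

theorem conjHom_eq_of_mk_eq {H : Subgroup G} {f : X →ₗ[k] Z}
    (hf : ∀ h ∈ H, conjHom X Z h f = f) {g g' : G} (hg : (g : G ⧸ H) = g') :
    conjHom X Z g f = conjHom X Z g' f := by
  have h1 := hf _ (QuotientGroup.eq.1 hg)
  conv_lhs => rw [← h1]
  rw [← Module.End.mul_apply, ← map_mul, mul_inv_cancel_left]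

theorem conjHom_sum_out {H : Subgroup G} [Fintype (G ⧸ H)] {f : X →ₗ[k] Z}
    (hf : ∀ h ∈ H, conjHom X Z h f = f) (g : G) :
    conjHom X Z g (∑ c : G ⧸ H, conjHom X Z c.out f) = ∑ c : G ⧸ H, conjHom X Z c.out f := by
  rw [map_sum, ← Equiv.sum_comp (MulAction.toPerm g) (fun c : G ⧸ H => conjHom X Z c.out f)]
  refine Finset.sum_congr rfl fun c _ => ?_
  rw [← Module.End.mul_apply, ← map_mul]
  apply conjHom_eq_of_mk_eq hf
  rw [QuotientGroup.out_eq', MulAction.toPerm_apply]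
  conv_rhs => rw [← QuotientGroup.out_eq' c]
  rfl

theorem isOpen_sup_openNormalSubgroup (D : Subgroup G) (N : OpenNormalSubgroup G) :
    IsOpen ((D ⊔ N.toSubgroup : Subgroup G) : Set G) :=
  Subgroup.isOpen_mono le_sup_right N.isOpen'

/-- Averaging over the cosets of a defect group turns a map which commutes with the defect group
into a module homomorphism. -/
theorem DefectProp.exists_average {p : ℕ} [Fact p.Prime] {e : CGA k G} {D : Subgroup G}
    (hD : DefectProp k G e D) {d : G} (hd : IsZpGenerator p D d)
    (hX : IsPseudocompactMod k (CGA k G) X)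
    {N : OpenNormalSubgroup G} (hZ : ∀ a ∈ levelIdeal k N, ∀ z : Z, a • z = 0)
    {f : X →ₗ[k] Z} (hf : IsOpen (LinearMap.ker f : Set X)) (hfd : conjHom X Z d f = f) :
    ∃ f' : X →ₗ[CGA k G] Z, IsOpen (LinearMap.ker f' : Set X) ∧
      ∀ x, (∀ g, f (ofG k G g • x) = ofG k G g • f x) → f' x = e • f x := by
  have := hX.addGroup
  have := hX.contSMul
  obtain ⟨N₁, hN₁⟩ := hX.exists_level (hf.mem_nhds (LinearMap.ker f).zero_mem)
  obtain ⟨M, hM⟩ := exists_openNormalSubgroup_le {N, N₁} (by simp)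
  obtain ⟨a, ha, hae⟩ := hD M
  set H := D ⊔ M.toSubgroup with hH
  have : Finite (G ⧸ H) := Subgroup.quotient_finite_of_isOpen H (isOpen_sup_openNormalSubgroup D M)
  have := Fintype.ofFinite (G ⧸ H)
  have hfH : ∀ h ∈ H, conjHom X Z h f = f := by
    let St : Subgroup G :=
      { carrier := {h | conjHom X Z h f = f}
        mul_mem' := fun {g h} hg hh => by
          change conjHom X Z (g * h) f = f
          rw [map_mul, Module.End.mul_apply, hh, hg]
        one_mem' := by
          change conjHom X Z 1 f = f
          rw [map_one, Module.End.one_apply]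
        inv_mem' := fun {g} hg => by
          change conjHom X Z g⁻¹ f = f
          conv_lhs => rw [← (show conjHom X Z g f = f from hg)]
          rw [← Module.End.mul_apply, ← map_mul, inv_mul_cancel, map_one, Module.End.one_apply] }
    have hM' : M.toSubgroup ≤ St := fun n hn =>
      conjHom_eq_of_mem_level (N := M)
        (fun a ha z => hZ a (levelIdeal_mono (hM N (by simp)) ha) z)
        (fun a ha x => hN₁ a (levelIdeal_mono (hM N₁ (by simp)) ha) x) hn
    have : H ≤ St := sup_le ((hd.le_sup M).trans
      (sup_le (Subgroup.zpowers_le.2 hfd) hM')) hM'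
    exact this
  let β : X →ₗ[k] Z := (Algebra.lsmul k k Z a) ∘ₗ f
  have hβ : ∀ x, β x = a • f x := fun _ => rfl
  have hβopen : IsOpen (LinearMap.ker β : Set X) :=
    isOpen_of_submodule_le (LinearMap.ker_le_ker_comp _ _) hf
  have hβH : ∀ h ∈ H, conjHom X Z h β = β := by
    intro h hh
    ext x
    have h1 := ha h⁻¹ (inv_mem hh)
    have h2 : ofG k G h * a = a * ofG k G h := by
      conv_lhs => rw [← h1, conjAct]
      rw [inv_inv, ← mul_assoc, ← mul_assoc, ← map_mul, mul_inv_cancel, map_one, one_mul]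
    have h3 := LinearMap.congr_fun (hfH h hh) x
    rw [conjHom_apply] at h3
    rw [conjHom_apply, hβ, hβ, ← mul_smul, h2, mul_smul, h3]
  let r : X →ₗ[k] Z := ∑ c : G ⧸ H, conjHom X Z c.out β
  have hrG : ∀ g : G, conjHom X Z g r = r := conjHom_sum_out hβH
  have hropen : IsOpen (LinearMap.ker r : Set X) :=
    isOpen_ker_sum _ _ fun c => isOpen_ker_conjHom _ hβopen
  obtain ⟨r', hr'⟩ := exists_linearMap_of_conjHom_eq hX hZ hropen hrG
  refine ⟨r', ?_, fun x hx => ?_⟩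
  · convert hropen using 1
    ext x
    exact (iff_of_eq (congrArg (· = 0) (hr' x)))
  · rw [hr', ← hae, trMap, finsum_eq_sum_of_fintype, Finset.sum_smul]
    change (∑ c : G ⧸ H, conjHom X Z c.out β) x = _
    rw [LinearMap.sum_apply]
    refine Finset.sum_congr rfl fun c _ => ?_
    rw [conjHom_apply, hβ, hx, conjAct, mul_smul, mul_smul]

end Averaging

section Extension

variable {k G} [IsTopologicalGroup G] [CompactSpace G] [TotallyDisconnectedSpace G] [T2Space G]
  {p : ℕ} [Fact p.Prime] [CharP k p]
  {Q X Z : Type} [AddCommGroup Q] [Module k Q] [Module (CGA k G) Q]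
  [IsScalarTower k (CGA k G) Q] [TopologicalSpace Q] [AddCommGroup X] [Module k X]
  [Module (CGA k G) X] [IsScalarTower k (CGA k G) X] [TopologicalSpace X]
  [AddCommGroup Z] [Module k Z] [Module (CGA k G) Z] [IsScalarTower k (CGA k G) Z]

theorem DefectProp.exists_extension {e : CGA k G} {D : Subgroup G}
    (hD : DefectProp k G e D) {d : G} (hd : IsZpGenerator p D d)
    (hQ : IsPseudocompactMod k (CGA k G) Q) (hproj : IsPCProjective k G Q)
    (hX : IsPseudocompactMod k (CGA k G) X) (hXe : InBlock (CGA k G) (X := X) e)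
    {N : OpenNormalSubgroup G} (hZ : ∀ a ∈ levelIdeal k N, ∀ z : Z, a • z = 0)
    (h : X →ₗ[CGA k G] Q) (hc : Continuous h) (q : LinearMap.ker h →ₗ[CGA k G] Z)
    (hq : IsOpen (LinearMap.ker q : Set (LinearMap.ker h))) :
    ∃ r : X →ₗ[CGA k G] Z, IsOpen (LinearMap.ker r : Set X) ∧
      ∀ u : LinearMap.ker h, r u = q u := by
  have := hX.addGroup
  have := hX.contSMul
  obtain ⟨r₀, hr₀, hr₀q⟩ := hX.isLinTop.exists_extend
    (U := (LinearMap.ker h).restrictScalars k) (q.restrictScalars k) hq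
  have hr₀q : ∀ u : LinearMap.ker h, r₀ u = q u := hr₀q
  have hcop : IsOpen (LinearMap.ker (conjHom X Z d r₀ - r₀) : Set X) := by
    simpa using isOpen_ker_conjHom_sub_one_pow d hr₀ 1
  have hker : LinearMap.ker (h.restrictScalars k) ≤ LinearMap.ker (conjHom X Z d r₀ - r₀) := by
    intro u hu
    have h1 := hr₀q ⟨u, hu⟩
    have h2 := hr₀q (ofG k G d⁻¹ • ⟨u, hu⟩)
    rw [map_smul] at h2
    rw [LinearMap.mem_ker, LinearMap.sub_apply, conjHom_apply, sub_eq_zero]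
    change r₀ (ofG k G d⁻¹ • u) = _ at h2
    change r₀ u = _ at h1
    rw [h2, h1, ← mul_smul, ← map_mul, mul_inv_cancel, map_one, one_smul]
  obtain ⟨C, hC, hCh⟩ := hX.isLinCpt.exists_factor hQ.isLinCpt (h.restrictScalars k) hc
    _ hcop hker
  obtain ⟨b, hb, hbC⟩ := exists_conjHom_sub_eq hQ hproj hZ hd hC
  let f : X →ₗ[k] Z := r₀ - b ∘ₗ h.restrictScalars k
  have hf : ∀ x, f x = r₀ x - b (h x) := fun _ => rfl
  have hfopen : IsOpen (LinearMap.ker f : Set X) := by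
    have h1 : IsOpen (LinearMap.ker (b ∘ₗ h.restrictScalars k) : Set X) := hb.preimage hc
    refine isOpen_of_submodule_le (V := LinearMap.ker r₀ ⊓ LinearMap.ker (b ∘ₗ h.restrictScalars k))
      (fun x hx => ?_) (hr₀.inter h1)
    have h2 : r₀ x = 0 := hx.1
    have h3 : b (h x) = 0 := hx.2
    rw [LinearMap.mem_ker, hf, h2, h3, sub_zero]
  have hfd : conjHom X Z d f = f := by
    ext x
    have h1 := LinearMap.congr_fun hbC (h x)
    have h2 := hCh x
    rw [LinearMap.sub_apply, conjHom_apply] at h1 h2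
    change C (h x) = _ at h2
    rw [conjHom_apply, hf, hf, smul_sub, h.map_smul]
    rw [h2] at h1
    rw [sub_eq_sub_iff_add_eq_add] at h1 ⊢
    rw [← h1, add_comm]
  obtain ⟨r, hr, hre⟩ := hD.exists_average hd hX hZ hfopen hfd
  have hfq : ∀ u : LinearMap.ker h, f u = q u := by
    intro u
    rw [hf, u.2, map_zero, sub_zero, hr₀q]
  refine ⟨r, hr, fun u => ?_⟩
  rw [hre u fun g => ?_, hfq, ← map_smul]
  · congr 1
    exact Subtype.ext (hXe u)
  · have h1 := hfq (ofG k G g • u)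
    rw [map_smul, ← hfq u] at h1
    exact h1

end Extension

section Hereditary

variable {k G} [IsTopologicalGroup G] [CompactSpace G] [TotallyDisconnectedSpace G] [T2Space G]
  {p : ℕ} [Fact p.Prime] [CharP k p]
  {Q X : Type} [AddCommGroup Q] [Module k Q] [Module (CGA k G) Q]
  [IsScalarTower k (CGA k G) Q] [TopologicalSpace Q] [AddCommGroup X] [Module k X]
  [Module (CGA k G) X] [IsScalarTower k (CGA k G) X] [TopologicalSpace X]

/-- A closed submodule is minimal among those mapping onto the same image only if it is
a complement to the kernel. -/
theorem DefectProp.exists_proper_closed {e : CGA k G} {D : Subgroup G}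
    (hD : DefectProp k G e D) {d : G} (hd : IsZpGenerator p D d)
    (hQ : IsPseudocompactMod k (CGA k G) Q) (hproj : IsPCProjective k G Q)
    (hX : IsPseudocompactMod k (CGA k G) X) (hXe : InBlock (CGA k G) (X := X) e)
    (h : X →ₗ[CGA k G] Q) (hc : Continuous h) {u : X} (hu : u ∈ LinearMap.ker h) (hu0 : u ≠ 0) :
    ∃ L : Submodule (CGA k G) X, IsClosed (L : Set X) ∧ u ∉ L ∧ L.map h = LinearMap.range h := by
  have := hX.addGroup
  have := hX.t2
  obtain ⟨V, hV, -, hVu⟩ := hX.exists_submodule (isOpen_compl_singleton.mem_nhds hu0.symm)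
  obtain ⟨N, hN⟩ := hX.exists_level (hV.mem_nhds V.zero_mem)
  let V' : Submodule (CGA k G) (LinearMap.ker h) := V.comap (LinearMap.ker h).subtype
  have hV' : IsOpen (LinearMap.ker V'.mkQ : Set (LinearMap.ker h)) := by
    rw [Submodule.ker_mkQ]
    exact hV.preimage continuous_subtype_val
  have hZ : ∀ a ∈ levelIdeal k N, ∀ z : LinearMap.ker h ⧸ V', a • z = 0 := by
    intro a ha z
    obtain ⟨y, rfl⟩ := V'.mkQ_surjective z
    rw [← map_smul]
    exact (Submodule.Quotient.mk_eq_zero _).2 (hN a ha y)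
  obtain ⟨r, hr, hrq⟩ := hD.exists_extension hd hQ hproj hX hXe hZ h hc V'.mkQ hV'
  refine ⟨LinearMap.ker r, ?_, fun hur => ?_, le_antisymm ?_ ?_⟩
  · exact isClosed_of_submodule_isOpen (V := LinearMap.ker (r.restrictScalars k)) hr
  · have h1 := hrq ⟨u, hu⟩
    rw [show r u = 0 from hur] at h1
    exact hVu ((Submodule.Quotient.mk_eq_zero V').1 h1.symm) rfl
  · exact LinearMap.map_le_range
  · rintro _ ⟨y, rfl⟩
    obtain ⟨w, hw⟩ := V'.mkQ_surjective (r y)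
    refine ⟨y - w, ?_, ?_⟩
    · change r (y - w) = 0
      rw [map_sub, hrq, hw, sub_self]
    · rw [map_sub, w.2, sub_zero]

theorem IsPCProjective.of_isClosed {e : CGA k G} (hec : e ∈ Set.center (CGA k G))
    (hei : IsIdempotentElem e) {D : Subgroup G} (hD : DefectProp k G e D) {d : G}
    (hd : IsZpGenerator p D d) (hQ : IsPseudocompactMod k (CGA k G) Q)
    (hQe : InBlock (CGA k G) (X := Q) e) (hproj : IsPCProjective k G Q)
    {K : Submodule (CGA k G) Q} (hK : IsClosed (K : Set Q)) : IsPCProjective k G K := by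
  intro Y _ _ _ _ _ hY f hf hfs
  have := hY.addGroup
  have := hY.contSMul
  have := hY.t2
  have hcomm : ∀ a : CGA k G, e * a = a * e := fun a => (Set.mem_center_iff.1 hec).comm a
  let E : Submodule (CGA k G) Y :=
    { carrier := {y | e • y = y}
      add_mem' := fun {y z} hy hz => by
        change e • (y + z) = y + z
        rw [smul_add, hy, hz]
      zero_mem' := smul_zero e
      smul_mem' := fun a y hy => by
        change e • a • y = a • y
        rw [← mul_smul, hcomm, mul_smul, hy] }
  let S : Set (Submodule (CGA k G) Y) :=
    {L | IsClosed (L : Set Y) ∧ L ≤ E ∧ ∀ x, ∃ y ∈ L, f y = x}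
  have hES : E ∈ S := by
    refine ⟨isClosed_eq (continuous_const_smul e) continuous_id, le_rfl, fun x => ?_⟩
    obtain ⟨y, rfl⟩ := hfs x
    refine ⟨e • y, ?_, ?_⟩
    · change e • e • y = e • y
      rw [← mul_smul, hei.eq]
    · rw [map_smul]
      exact Subtype.ext (hQe _)
  have hchain : ∀ c ⊆ S, IsChain (· ≤ ·) c → ∃ I ∈ S, ∀ L ∈ c, I ≤ L := by
    intro c hcS hc
    rcases c.eq_empty_or_nonempty with rfl | hne
    · exact ⟨E, hES, by simp⟩
    have := hne.to_subtype
    refine ⟨⨅ L : c, L.1, ⟨?_, ?_, fun x => ?_⟩, fun L hL => iInf_le (fun L : c => L.1) ⟨L, hL⟩⟩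
    · rw [Submodule.coe_iInf]
      exact isClosed_iInter fun L => (hcS L.2).1
    · obtain ⟨L, hL⟩ := hne
      exact (iInf_le (fun L : c => L.1) ⟨L, hL⟩).trans
        (hcS hL).2.1
    · choose y hy using fun L : c => (hcS L.2).2.2 x
      have hkc : IsClosed (LinearMap.ker f : Set Y) := by
        have := hQ.t2
        exact isClosed_eq hf continuous_const
      obtain ⟨z, hz⟩ := hY.isLinCpt.inter (fun L : c =>
        (L.1 ⊓ LinearMap.ker f).restrictScalars k) y
        (fun L => (hcS L.2).1.inter hkc) fun L L' => by
          rcases hc.total L'.2 L.2 with hle | hle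
          · refine ⟨L', fun z hz => ⟨hle hz.1, hz.2⟩, le_rfl, ⟨?_, ?_⟩, ?_⟩
            · exact sub_mem (hle (hy L').1) (hy L).1
            · exact LinearMap.sub_mem_ker_iff.2 (by rw [(hy L).2, (hy L').2])
            · rw [sub_self]
              exact zero_mem _
          · refine ⟨L, le_rfl, fun z hz => ⟨hle hz.1, hz.2⟩, ?_, ⟨?_, ?_⟩⟩
            · rw [sub_self]
              exact zero_mem _
            · exact sub_mem (hle (hy L).1) (hy L').1
            · exact LinearMap.sub_mem_ker_iff.2 (by rw [(hy L).2, (hy L').2])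
      refine ⟨z, (Submodule.mem_iInf _).2 fun L => ?_, ?_⟩
      · have h1 := add_mem (hz L).1 (hy L).1
        rwa [sub_add_cancel] at h1
      · obtain ⟨L, hL⟩ := hne
        have h1 := LinearMap.sub_mem_ker_iff.1 (hz ⟨L, hL⟩).2
        rw [h1, (hy ⟨L, hL⟩).2]
  obtain ⟨L', hL⟩ : ∃ L, Minimal (· ∈ S) L :=
    (@zorn_le₀ (Submodule (CGA k G) Y)ᵒᵈ _ S) fun c hcS hc => hchain c hcS hc.symm
  obtain ⟨hLc, hLE, hLs⟩ := hL.1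
  have hLpc := hY.of_isClosed hLc
  have hKpc := hQ.of_isClosed hK
  let g : L' →ₗ[CGA k G] K := f ∘ₗ L'.subtype
  have hgc : Continuous g := hf.comp continuous_subtype_val
  have hgs : Function.Surjective g := fun x => by
    obtain ⟨y, hy, hyx⟩ := hLs x
    exact ⟨⟨y, hy⟩, hyx⟩
  have hgi : Function.Injective g := by
    rw [injective_iff_map_eq_zero]
    intro u hu
    by_contra hu0
    obtain ⟨M, hMc, hMu, hM⟩ := hD.exists_proper_closed hd hQ hproj hLpc
      (fun y => Subtype.ext (hLE y.2)) (K.subtype ∘ₗ g) (continuous_subtype_val.comp hgc)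
      (u := u) (by
        rw [LinearMap.mem_ker, LinearMap.comp_apply, hu, map_zero]) hu0
    have hMS : M.map L'.subtype ∈ S := by
      refine ⟨?_, (Submodule.map_subtype_le _ _).trans hLE, fun x => ?_⟩
      · rw [Submodule.map_coe]
        exact hLc.isClosedEmbedding_subtypeVal.isClosedMap _ hMc
      · obtain ⟨y, rfl⟩ := hgs x
        obtain ⟨z, hz, hzy⟩ : (K.subtype ∘ₗ g) y ∈ M.map (K.subtype ∘ₗ g) := by
          rw [hM]
          exact ⟨y, rfl⟩
        exact ⟨z, ⟨z, hz, rfl⟩, Subtype.ext hzy⟩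
    have h1 : L' ≤ M.map L'.subtype :=
      hL.2 hMS (Submodule.map_subtype_le _ _)
    obtain ⟨w, hw, hwu⟩ := h1 u.2
    exact hMu (Subtype.ext hwu ▸ hw)
  let g' := LinearEquiv.ofBijective g ⟨hgi, hgs⟩
  have hg' : Continuous g'.symm := by
    have := hKpc.addGroup
    have := hLpc.addGroup
    refine continuous_of_continuousAt_zero g'.symm ?_
    rw [ContinuousAt, map_zero]
    intro s hs
    obtain ⟨V, hV, -, hVs⟩ := hLpc.exists_submodule hs
    have h1 := hLpc.isLinCpt.isOpen_map hKpc.isLinTop (g.restrictScalars k) hgc hgs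
      (V := V.restrictScalars k) hV
    rw [Filter.mem_map]
    refine Filter.mem_of_superset (h1.mem_nhds (Submodule.zero_mem _)) ?_
    rintro _ ⟨v, hv, rfl⟩
    change g'.symm (g' v) ∈ s
    rw [LinearEquiv.symm_apply_apply]
    exact hVs hv
  refine ⟨L'.subtype ∘ₗ g'.symm.toLinearMap, continuous_subtype_val.comp hg', ?_⟩
  ext1 x
  exact g'.apply_symm_apply x

end Hereditary

section Block

variable {k G} [IsTopologicalGroup G] [CompactSpace G] [TotallyDisconnectedSpace G] [T2Space G]
  {p : ℕ} [Fact p.Prime] [CharP k p]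

theorem isPseudocompactMod_quotient {N : OpenNormalSubgroup G}
    {m : Submodule (CGA k G) (CGA k G)} (hN : levelIdeal k N ≤ m) :
    IsPseudocompactMod k (CGA k G) (CGA k G ⧸ m) ∧ DiscreteTopology (CGA k G ⧸ m) := by
  have hm : IsOpen (m : Set (CGA k G)) :=
    isOpen_of_submodule_le (V := (levelIdeal k N).restrictScalars k) (W := m.restrictScalars k)
      hN (isOpen_levelIdeal N)
  have hdisc : DiscreteTopology (CGA k G ⧸ m) := QuotientAddGroup.discreteTopology hm
  have := finiteDimensional_quotient_levelIdeal (k := k) N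
  have : FiniteDimensional k (CGA k G ⧸ m) :=
    finiteDimensional_quotient_of_le (V := (levelIdeal k N).restrictScalars k)
      (W := m.restrictScalars k) hN
  refine ⟨isPseudocompactMod_of_discrete N fun a ha x => ?_, hdisc⟩
  obtain ⟨x, rfl⟩ := m.mkQ_surjective x
  rw [← map_smul]
  refine (Submodule.Quotient.mk_eq_zero m).2 (hN ?_)
  rw [mem_levelIdeal] at ha ⊢
  rw [smul_eq_mul, map_mul, ha, zero_mul]

theorem exists_simple_not_projective {e : CGA k G} (hec : e ∈ Set.center (CGA k G))
    (hei : IsIdempotentElem e) (he0 : e ≠ 0) {D : Subgroup G} {d : G}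
    (hd : IsZpGenerator p D d) :
    ∃ m : Submodule (CGA k G) (CGA k G), IsSimpleModule (CGA k G) (CGA k G ⧸ m) ∧
      InBlock (CGA k G) (X := CGA k G ⧸ m) e ∧ ¬ IsPCProjective k G (CGA k G ⧸ m) := by
  obtain ⟨N, hN⟩ := exists_projHom_ne_zero he0
  have hcomm : ∀ a : CGA k G, e * a = a * e := fun a => (Set.mem_center_iff.1 hec).comm a
  let I : Ideal (CGA k G) := (levelIdeal k N).comap (LinearMap.toSpanSingleton _ _ e)
  have hI : ∀ a, a ∈ I ↔ projHom k N (a * e) = 0 := fun a => mem_levelIdeal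
  have hIt : I ≠ ⊤ := fun h => by
    have h1 : (1 : CGA k G) ∈ I := h ▸ Submodule.mem_top
    rw [hI, one_mul] at h1
    exact hN h1
  obtain ⟨m, hm, hIm⟩ := Ideal.exists_le_maximal I hIt
  have hNm : levelIdeal k N ≤ m := fun a ha => hIm (by
    rw [hI, map_mul, mem_levelIdeal.1 ha, zero_mul])
  have hsimple : IsSimpleModule (CGA k G) (CGA k G ⧸ m) :=
    isSimpleModule_iff_isCoatom.2 hm.out
  refine ⟨m, hsimple, fun x => ?_, fun hproj => ?_⟩
  · obtain ⟨x, rfl⟩ := m.mkQ_surjective x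
    rw [← map_smul]
    refine (Submodule.Quotient.eq m).2 (hIm ?_)
    rw [hI, sub_mul, smul_eq_mul, hcomm, mul_assoc, hei.eq, sub_self, map_zero]
  · obtain ⟨hpc, hdisc⟩ := isPseudocompactMod_quotient hNm
    have := hsimple.nontrivial
    exact not_subsingleton _ (hproj.subsingleton_of_isOpen_bot hpc (isOpen_discrete _) hd)

end Block

theorem exists_functional_of_disjoint {k X : Type} [Field k] [AddCommGroup X] [Module k X]
    {W R : Submodule k X} (f : W →ₗ[k] k) (h : ∀ x : W, (x : X) ∈ R → f x = 0) :
    ∃ F : X →ₗ[k] k, (∀ x : W, F x = f x) ∧ ∀ x ∈ R, F x = 0 := by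
  have h1 : f ∈ LinearMap.range (R.mkQ ∘ₗ W.subtype).dualMap := by
    rw [LinearMap.range_dualMap_eq_dualAnnihilator_ker, Submodule.mem_dualAnnihilator]
    exact fun x hx => h x ((Submodule.Quotient.mk_eq_zero R).1 hx)
  obtain ⟨F, hF⟩ := h1
  exact ⟨F ∘ₗ R.mkQ, fun x => LinearMap.congr_fun hF x, fun x hx => by
    rw [LinearMap.comp_apply, Submodule.mkQ_apply, (Submodule.Quotient.mk_eq_zero R).2 hx,
      map_zero]⟩

section Retraction

variable {k G} [IsTopologicalGroup G] [CompactSpace G]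
  {X : Type} [AddCommGroup X] [Module k X] [Module (CGA k G) X]
  [IsScalarTower k (CGA k G) X] [TopologicalSpace X]

/-- A projective submodule `K` of `X` comes with an open submodule `J` such that the projection of
`K` onto a given finite-dimensional quotient extends to `X` as soon as `X` has an open subspace
that contains all `n • x - x` and meets `K` inside `J`. -/
theorem IsPCProjective.exists_extension_of_disjoint (hX : IsPseudocompactMod k (CGA k G) X)
    {K : Submodule (CGA k G) X} (hK : IsPseudocompactMod k (CGA k G) K)
    (hproj : IsPCProjective k G K) {V : Submodule (CGA k G) K} (hV : IsOpen (V : Set K))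
    [FiniteDimensional k (K ⧸ V.restrictScalars k)] {N : OpenNormalSubgroup G}
    (hN : ∀ a ∈ levelIdeal k N, ∀ x : K, a • x ∈ V) :
    ∃ J : Submodule (CGA k G) K, IsOpen (J : Set K) ∧
      (∀ n ∈ N.toSubgroup, ∀ x : K, ofG k G n • x - x ∈ J) ∧
      ∀ R : Submodule k X, IsOpen (R : Set X) →
        (∀ n ∈ N.toSubgroup, ∀ x : X, ofG k G n • x - x ∈ R) →
        (∀ x : K, (x : X) ∈ R → x ∈ J) →
        ∃ r : X →ₗ[CGA k G] K ⧸ V, IsOpen (LinearMap.ker r : Set X) ∧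
          ∀ x : K, r x = V.mkQ x := by
  have := hX.addGroup
  have := hX.contSMul
  obtain ⟨ι, _, v, l, hlc, hl⟩ := hproj.hasDualBases hK hV
  have hZ : ∀ a ∈ levelIdeal k N, ∀ z : K ⧸ V, a • z = 0 := by
    intro a ha z
    obtain ⟨y, rfl⟩ := V.mkQ_surjective z
    rw [← map_smul]
    exact (Submodule.Quotient.mk_eq_zero V).2 (hN a ha y)
  have hn1 : ∀ n ∈ N.toSubgroup, ofG k G n - 1 ∈ levelIdeal k N := by
    intro n hn
    have := ofG_sub_ofG_mem (k := k) (N := N) (g := n) (h := 1) ((QuotientGroup.eq_one_iff _).2 hn)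
    rwa [map_one] at this
  have hn2 : ∀ n ∈ N.toSubgroup, ∀ z : K ⧸ V, ofG k G n • z = z := by
    intro n hn z
    have := hZ _ (hn1 n hn) z
    rwa [sub_smul, one_smul, sub_eq_zero] at this
  let J : Submodule (CGA k G) K := V ⊓ ⨅ i, (levelIdeal k N).comap (l i)
  have hJ : ∀ x, x ∈ J ↔ x ∈ V ∧ ∀ i, l i x ∈ levelIdeal k N := by
    intro x
    simp [J]
  refine ⟨J, ?_, fun n hn x => (hJ _).2 ⟨?_, fun i => ?_⟩, fun R hR hRN hRJ => ?_⟩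
  · have h1 : (J : Set K) = (V : Set K) ∩ ⋂ i, l i ⁻¹' (levelIdeal k N : Set (CGA k G)) := by
      ext x
      simpa using hJ x
    rw [h1]
    exact hV.inter (isOpen_iInter_of_finite fun i => (isOpen_levelIdeal N).preimage (hlc i))
  · convert hN _ (hn1 n hn) x using 1
    ext1
    change ofG k G n • (x : X) - x = (ofG k G n - 1) • (x : X)
    rw [sub_smul, one_smul]
  · rw [map_sub, map_smul, smul_eq_mul, ← sub_one_mul, mem_levelIdeal, map_mul, mem_levelIdeal.1 (hn1 n hn), zero_mul]
  · have hF : ∀ i, ∃ F : X →ₗ[k] k, (∀ x : K, F x = coeffAt N 1 (l i x)) ∧ ∀ x ∈ R, F x = 0 :=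
      fun i => exists_functional_of_disjoint (W := K.restrictScalars k)
        (coeffAt N 1 ∘ₗ (l i).restrictScalars k)
        fun x hx => coeffAt_eq_zero _ (((hJ x).1 (hRJ x hx)).2 i)
    choose F hFl hFR using hF
    let b : ι → X →ₗ[k] K ⧸ V := fun i => (F i).smulRight (V.mkQ (v i))
    have hb : ∀ i x, b i x = F i x • V.mkQ (v i) := fun _ _ => rfl
    have hbopen : ∀ i, IsOpen (LinearMap.ker (b i) : Set X) := fun i =>
      isOpen_of_submodule_le (V := R) (fun x hx => by
        rw [LinearMap.mem_ker, hb, hFR i x hx, zero_smul]) hR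
    have hbN : ∀ i, ∀ n ∈ N.toSubgroup, conjHom X (K ⧸ V) n (b i) = b i := by
      refine fun i n hn => conjHom_eq_of_apply_smul fun x => ?_
      have h1 := hFR i _ (hRN _ (inv_mem hn) x)
      rw [map_sub, sub_eq_zero] at h1
      rw [hn2 _ (inv_mem hn), hb, hb, h1]
    let r : X →ₗ[k] K ⧸ V := ∑ i, ∑ c : G ⧸ N.toSubgroup, conjHom X (K ⧸ V) c.out (b i)
    have hropen : IsOpen (LinearMap.ker r : Set X) :=
      isOpen_ker_sum _ _ fun i => isOpen_ker_sum _ _ fun c => isOpen_ker_conjHom _ (hbopen i)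
    obtain ⟨r', hr'⟩ := exists_linearMap_of_conjHom_eq hX hZ hropen fun g => by
      rw [map_sum]
      exact Finset.sum_congr rfl fun i _ => conjHom_sum_out (hbN i) g
    refine ⟨r', ?_, fun x => ?_⟩
    · convert hropen using 1
      ext x
      exact (iff_of_eq (congrArg (· = 0) (hr' x)))
    · have h1 : r x = ∑ i, l i x • V.mkQ (v i) := by
        change (∑ i, ∑ c : G ⧸ N.toSubgroup, conjHom X (K ⧸ V) c.out (b i)) (x : X) = _
        rw [LinearMap.sum_apply]
        refine Finset.sum_congr rfl fun i _ => ?_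
        have h2 := hZ _ (sub_sum_mem_levelIdeal N (l i x)) (V.mkQ (v i))
        rw [sub_smul, sub_eq_zero] at h2
        rw [h2, LinearMap.sum_apply, Finset.sum_smul]
        refine Finset.sum_congr rfl fun c _ => ?_
        have h3 := hFl i (ofG k G c.out⁻¹ • x)
        rw [map_smul, smul_eq_mul, coeffAt_ofG_mul, coeffAt_apply] at h3
        rw [conjHom_apply, hb]
        change F i (ofG k G c.out⁻¹ • (x : X)) = _ at h3
        rw [h3, smul_assoc, smul_comm]
        congr 3
        rw [mul_one, QuotientGroup.mk_inv, inv_inv, QuotientGroup.out_eq']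
      rw [hr', h1]
      simp only [← map_smul]
      rw [← map_sum, eq_comm]
      exact (Submodule.Quotient.eq V).2 (hl x)

end Retraction

theorem relIndex_sup_of_normal {Γ : Type} [Group Γ] (H N : Subgroup Γ) [N.Normal]
    (h : N.relIndex H ≠ 0) : H.relIndex (H ⊔ N) = H.relIndex N := by
  have h1 := Subgroup.relIndex_mul_relIndex (H ⊓ N) N (H ⊔ N) inf_le_right le_sup_right
  have h2 := Subgroup.relIndex_mul_relIndex (H ⊓ N) H (H ⊔ N) inf_le_left le_sup_left
  rw [Subgroup.inf_relIndex_right, Subgroup.relIndex_sup_right] at h1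
  rw [Subgroup.inf_relIndex_left, ← h1, mul_comm] at h2
  exact Nat.eq_of_mul_eq_mul_right (Nat.pos_of_ne_zero h) h2

section Index

variable {k G} [IsTopologicalGroup G] [CompactSpace G] {p : ℕ} [Fact p.Prime] [CharP k p]

theorem DefectProp.not_dvd_relIndex {e : CGA k G} {D : Subgroup G} (hD : DefectProp k G e D)
    {S : Type} [AddCommGroup S] [Module (CGA k G) S] [Nontrivial S]
    (hSe : InBlock (CGA k G) (X := S) e) {M N : OpenNormalSubgroup G}
    (hN : ∀ n ∈ N.toSubgroup, ∀ x : S, ofG k G n • x = x) :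
    ¬ p ∣ (D ⊔ M.toSubgroup).relIndex N.toSubgroup := by
  intro hp
  obtain ⟨a, ha, hae⟩ := hD M
  set H := D ⊔ M.toSubgroup with hH
  have hfin : Finite (G ⧸ H) :=
    Subgroup.quotient_finite_of_isOpen H (isOpen_sup_openNormalSubgroup D M)
  have : Finite (G ⧸ H ⊔ N.toSubgroup) := Subgroup.quotient_finite_of_isOpen _
    (Subgroup.isOpen_mono le_sup_left (isOpen_sup_openNormalSubgroup D M))
  have := Fintype.ofFinite (G ⧸ H)
  have := Fintype.ofFinite (G ⧸ H ⊔ N.toSubgroup)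
  have : N.toSubgroup.FiniteIndex := Subgroup.finiteIndex_of_finite_quotient
  rw [← relIndex_sup_of_normal H N.toSubgroup fun h =>
    Subgroup.FiniteIndex.index_ne_zero (zero_dvd_iff.1 (h ▸
      Subgroup.relIndex_dvd_index_of_normal N.toSubgroup H))] at hp
  let F : G → S → S := fun g x => conjAct k G g a • x
  have hmul : ∀ (g h : G) (x : S), F (g * h) x = ofG k G g • F h (ofG k G g⁻¹ • x) := by
    intro g h x
    simp only [F, conjAct, ← mul_smul, mul_inv_rev, map_mul, mul_assoc]
  have hF1 : ∀ x : S, F 1 x = a • x := by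
    intro x
    simp only [F, conjAct, inv_one, map_one, one_mul, mul_one]
  let St : Subgroup G :=
    { carrier := {h | ∀ x, F h x = a • x}
      mul_mem' := fun {g h} hg hh x => by
        rw [hmul, hh, ← hF1, ← hmul, mul_one, hg]
      one_mem' := hF1
      inv_mem' := fun {g} hg x => by
        have h1 := hmul g⁻¹ g x
        rw [inv_mul_cancel, hF1, hg, ← hF1 (ofG k G g⁻¹⁻¹ • x), ← hmul, mul_one] at h1
        exact h1.symm }
  have hSt : H ⊔ N.toSubgroup ≤ St := by
    refine sup_le (fun h hh x => ?_) fun n hn x => ?_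
    · change conjAct k G h a • x = _
      rw [ha h hh]
    · change (ofG k G n * a * ofG k G n⁻¹) • x = _
      rw [mul_smul, mul_smul, hN _ hn, hN _ (inv_mem hn)]
  have hF : ∀ (g h : G) (x : S), h ∈ H ⊔ N.toSubgroup → F (g * h) x = F g x := by
    intro g h x hh
    rw [hmul, hSt hh, ← hF1, ← hmul, mul_one]
  obtain ⟨x, hx⟩ := exists_ne (0 : S)
  refine hx ?_
  rw [← hSe x, ← hae, trMap, finsum_eq_sum_of_fintype, Finset.sum_smul]
  let E := Subgroup.quotientEquivProdOfLE (show H ≤ H ⊔ N.toSubgroup from le_sup_left)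
  have hE : ∀ c : G ⧸ H, F c.out x = F (E c).1.out x := by
    intro c
    have h1 : ((E c).1.out : G ⧸ H ⊔ N.toSubgroup) = (c.out : G ⧸ H ⊔ N.toSubgroup) := by
      rw [QuotientGroup.out_eq']
      conv_lhs => rw [← QuotientGroup.out_eq' c]
      rfl
    have h2 := QuotientGroup.eq.1 h1
    have h3 := hF (E c).1.out _ x h2
    rwa [← mul_assoc, mul_inv_cancel, one_mul] at h3
  have : Finite (↥(H ⊔ N.toSubgroup) ⧸ H.subgroupOf (H ⊔ N.toSubgroup)) :=
    Finite.of_injective (fun j => E.symm (⟦1⟧, j)) fun i j hij => by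
      simpa using hij
  have := Fintype.ofFinite (↥(H ⊔ N.toSubgroup) ⧸ H.subgroupOf (H ⊔ N.toSubgroup))
  change ∑ c : G ⧸ H, F c.out x = 0
  rw [Finset.sum_congr rfl fun c _ => hE c, Equiv.sum_comp E fun y => F y.1.out x,
    Fintype.sum_prod_type]
  refine Finset.sum_eq_zero fun c _ => ?_
  change ∑ _j : ↥(H ⊔ N.toSubgroup) ⧸ H.subgroupOf (H ⊔ N.toSubgroup), F c.out x = 0
  rw [Finset.sum_const, Finset.card_univ, ← Nat.card_eq_fintype_card]
  change H.relIndex (H ⊔ N.toSubgroup) • _ = _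
  obtain ⟨m, hm⟩ := hp
  rw [hm, mul_comm, mul_smul, ← Nat.cast_smul_eq_nsmul (CGA k G) p,
    ← map_natCast (algebraMap k (CGA k G)), CharP.cast_eq_zero, map_zero, zero_smul, smul_zero]

end Index

section Coinvariants

variable {k G} [IsTopologicalGroup G] [CompactSpace G] {p : ℕ} [Fact p.Prime] [CharP k p]
  {X : Type} [AddCommGroup X] [Module k X] [Module (CGA k G) X]
  [IsScalarTower k (CGA k G) X] [TopologicalSpace X]

theorem DefectProp.smul_sub_mem_sup_span {e : CGA k G} {D : Subgroup G} (hD : DefectProp k G e D)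
    {d : G} (hd : IsZpGenerator p D d) (hX : IsPseudocompactMod k (CGA k G) X)
    (hXe : InBlock (CGA k G) (X := X) e) {N : OpenNormalSubgroup G} {d₀ : G}
    (hd₀ : Subgroup.zpowers d ⊓ N.toSubgroup = Subgroup.zpowers d₀)
    {K L : Submodule (CGA k G) X} (hL : IsOpen (L : Set X)) (hKt : K ≠ ⊤)
    (hNK : ∀ n ∈ N.toSubgroup, ∀ x : X, ofG k G n • x - x ∈ K)
    (hNL : ∀ n ∈ N.toSubgroup, ∀ x ∈ K, ofG k G n • x - x ∈ L)
    {n : G} (hn : n ∈ N.toSubgroup) (x : X) :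
    ofG k G n • x - x ∈ L.restrictScalars k ⊔ Submodule.span k {ofG k G d₀ • x - x} := by
  set T := L.restrictScalars k ⊔ Submodule.span k {ofG k G d₀ • x - x}
  have hLT : ∀ y ∈ L, y ∈ T := fun y hy => Submodule.mem_sup_left hy
  obtain ⟨M₁, hM₁⟩ := hX.exists_level (hL.mem_nhds L.zero_mem)
  obtain ⟨M, hM⟩ := exists_openNormalSubgroup_le {N, M₁} (by simp)
  have hMN : M.toSubgroup ≤ N.toSubgroup := hM N (by simp)
  let φ : N.toSubgroup →* Multiplicative (X ⧸ T) :=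
    { toFun := fun n => Multiplicative.ofAdd (T.mkQ (ofG k G n • x - x))
      map_one' := by
        simp
      map_mul' := fun n m => by
        rw [← ofAdd_add, ← map_add]
        congr 1
        refine (Submodule.Quotient.eq T).2 (hLT _ ?_)
        have h1 := hNL n n.2 _ (hNK m m.2 x)
        rw [Subgroup.coe_mul, map_mul, mul_smul]
        rw [smul_sub] at h1
        convert h1 using 1
        abel }
  have hφ : ∀ n, φ n = 1 ↔ ofG k G n • x - x ∈ T := fun n =>
    Submodule.Quotient.mk_eq_zero T
  have hker : (D ⊔ M.toSubgroup).subgroupOf N.toSubgroup ≤ φ.ker := by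
    rintro ⟨y, hyN⟩ hy
    have hy' : y ∈ Subgroup.zpowers d ⊔ M.toSubgroup :=
      (sup_le (hd.le_sup M) le_sup_right : D ⊔ M.toSubgroup ≤ _) hy
    obtain ⟨a, ha, m, hm, rfl⟩ := Subgroup.mem_sup_of_normal_right.1 hy'
    have haN : a ∈ N.toSubgroup := (Subgroup.mul_mem_cancel_right _ (hMN hm)).1 hyN
    have hd₀N : d₀ ∈ N.toSubgroup := (hd₀.ge (Subgroup.mem_zpowers d₀)).2
    obtain ⟨j, rfl⟩ := hd₀.le ⟨ha, haN⟩
    have h1 : φ ⟨d₀, hd₀N⟩ = 1 :=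
      (hφ _).2 (Submodule.mem_sup_right (Submodule.mem_span_singleton_self _))
    have h2 : φ ⟨m, hMN hm⟩ = 1 := by
      refine (hφ _).2 (hLT _ ?_)
      have h3 := ofG_sub_ofG_mem (k := k) (N := M) (g := m) (h := 1)
        ((QuotientGroup.eq_one_iff _).2 hm)
      have h4 := hM₁ _ (levelIdeal_mono (hM M₁ (by simp)) h3) x
      rwa [map_one, sub_smul, one_smul] at h4
    have h3 : (⟨d₀ ^ j * m, hyN⟩ : N.toSubgroup) = ⟨d₀, hd₀N⟩ ^ j * ⟨m, hMN hm⟩ := rfl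
    rw [MonoidHom.mem_ker]
    change φ ⟨d₀ ^ j * m, hyN⟩ = 1
    rw [h3, map_mul, map_zpow, h1, h2, one_zpow, one_mul]
  by_contra hnT
  have hp : orderOf (φ ⟨n, hn⟩) = p := by
    refine orderOf_eq_prime ?_ fun h => hnT ((hφ _).1 h)
    change Multiplicative.ofAdd (p • T.mkQ (ofG k G n • x - x)) = 1
    rw [← Nat.cast_smul_eq_nsmul k, CharP.cast_eq_zero, zero_smul]
    rfl
  have h1 : p ∣ Nat.card φ.range := by
    rw [← hp]
    exact Subgroup.orderOf_dvd_natCard _ ⟨_, rfl⟩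
  rw [← Subgroup.index_ker] at h1
  have : Nontrivial (X ⧸ K) := Submodule.Quotient.nontrivial_iff.2 hKt
  refine hD.not_dvd_relIndex (S := X ⧸ K) (fun z => ?_) (N := N) (fun n hn z => ?_)
    (h1.trans (Subgroup.index_dvd_of_le hker))
  · obtain ⟨y, rfl⟩ := K.mkQ_surjective z
    rw [← map_smul, hXe]
  · obtain ⟨y, rfl⟩ := K.mkQ_surjective z
    rw [← map_smul]
    exact (Submodule.Quotient.eq K).2 (hNK n hn y)

end Coinvariants

section Coatom

theorem exists_isCoatom_of_isOpen {k A X : Type} [Field k] [Ring A] [Algebra k A]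
    [TopologicalSpace A] [AddCommGroup X] [Module k X] [Module A X] [IsScalarTower k A X]
    [TopologicalSpace X] (hX : IsPseudocompactMod k A X) {W : Submodule A X}
    (hW : IsOpen (W : Set X)) (hWt : W ≠ ⊤) :
    ∃ M : Submodule A X, W ≤ M ∧ IsCoatom M ∧ IsOpen (M : Set X) := by
  have := hX.addGroup
  obtain ⟨V, -, _, hVW⟩ := hX.exists_submodule (hW.mem_nhds W.zero_mem)
  have : FiniteDimensional k (X ⧸ W) :=
    finiteDimensional_quotient_of_le (V := V.restrictScalars k) (W := W.restrictScalars k) hVW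
  have : IsNoetherian A (X ⧸ W) := isNoetherian_of_tower k inferInstance
  have : Nontrivial (X ⧸ W) := Submodule.Quotient.nontrivial_iff.2 hWt
  obtain ⟨M, hM, -⟩ := (eq_top_or_exists_le_coatom (⊥ : Submodule A (X ⧸ W))).resolve_left bot_ne_top
  have hWM : W ≤ M.comap W.mkQ := W.le_comap_mkQ M
  exact ⟨M.comap W.mkQ, hWM, Submodule.isCoatom_comap_iff W.mkQ_surjective |>.2 hM,
    isOpen_of_submodule_le hWM hW⟩

variable {k : Type} [Field k] {A X : Type} [Ring A] [Algebra k A]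
    [TopologicalSpace A] [AddCommGroup X] [Module k X] [Module A X] [IsScalarTower k A X]
    [TopologicalSpace X]

theorem le_of_isCoatom_of_le_radical (hX : IsPseudocompactMod k A X) {K : Submodule A X}
    (hK : IsCoatom K) (hKr : K ≤ radical A X) {W : Submodule A X} (hW : IsOpen (W : Set X))
    (hWt : W ≠ ⊤) : W ≤ K ∧ IsOpen (K : Set X) := by
  obtain ⟨M, hWM, hM, hMo⟩ := exists_isCoatom_of_isOpen hX hW hWt
  obtain rfl : K = M := (hK.le_iff.1 (hKr.trans (sInf_le ⟨hM, hMo⟩))).resolve_left hM.1 |>.symm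
  exact ⟨hWM, hMo⟩

theorem isOpen_of_isCoatom_of_le_radical (hX : IsPseudocompactMod k A X) {K : Submodule A X}
    (hK : IsCoatom K) (hKr : K ≤ radical A X) : IsOpen (K : Set X) := by
  have := hX.t2
  obtain ⟨u, hu⟩ : ∃ u, u ∉ K := by
    by_contra! h
    exact hK.1 (Submodule.eq_top_iff'.2 h)
  have hu0 : u ≠ 0 := fun h => hu (h ▸ K.zero_mem)
  obtain ⟨V, hV, -, hVu⟩ := hX.exists_submodule (isOpen_compl_singleton.mem_nhds hu0.symm)
  exact (le_of_isCoatom_of_le_radical hX hK hKr hV fun h => hVu (h ▸ Submodule.mem_top) rfl).2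

/-- A finite quotient of a submodule of a proper submodule `K` containing every proper open
submodule does not extend to the whole module. -/
theorem not_exists_extension {K K₁ : Submodule A X} (hKt : K ≠ ⊤)
    (hK : ∀ W : Submodule A X, IsOpen (W : Set X) → W ≠ ⊤ → W ≤ K) (hK₁ : K₁ ≤ K)
    {V : Submodule A K₁} (hV : V ≠ ⊤) :
    ¬ ∃ r : X →ₗ[A] K₁ ⧸ V, IsOpen (LinearMap.ker r : Set X) ∧ ∀ x : K₁, r x = V.mkQ x := by
  rintro ⟨r, hr, hrq⟩
  by_cases h : LinearMap.ker r = ⊤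
  · refine hV (Submodule.eq_top_iff'.2 fun x => (Submodule.Quotient.mk_eq_zero V).1 ?_)
    have h1 : r x = 0 := (h.ge Submodule.mem_top : (x : X) ∈ LinearMap.ker r)
    exact (hrq x).symm.trans h1
  · refine hKt (Submodule.eq_top_iff'.2 fun x => ?_)
    obtain ⟨y, hy⟩ := V.mkQ_surjective (r x)
    have h1 := hK _ hr h (LinearMap.sub_mem_ker_iff.2 ((hrq y).trans hy))
    exact (Submodule.sub_mem_iff_right K (hK₁ y.2)).1 h1

end Coatom

section Decomposition

variable {k G} [IsTopologicalGroup G] [CompactSpace G] [TotallyDisconnectedSpace G] [T2Space G]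
  {p : ℕ} [Fact p.Prime] [CharP k p]
  {X : Type} [AddCommGroup X] [Module k X] [Module (CGA k G) X]
  [IsScalarTower k (CGA k G) X] [TopologicalSpace X]

theorem DefectProp.smul_sub_mem_of_isCoatom {e : CGA k G} {D : Subgroup G} (hD : DefectProp k G e D)
    {d : G} (hd : IsZpGenerator p D d) (hX : IsPseudocompactMod k (CGA k G) X)
    (hXe : InBlock (CGA k G) (X := X) e) {N : OpenNormalSubgroup G} {d₀ : G}
    (hd₀ : Subgroup.zpowers d ⊓ N.toSubgroup = Subgroup.zpowers d₀)
    {K L₀ L : Submodule (CGA k G) X} (hL₀ : IsOpen (L₀ : Set X)) (hK : IsCoatom K)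
    (hNK : ∀ n ∈ N.toSubgroup, ∀ x : X, ofG k G n • x - x ∈ K)
    (hNL : ∀ n ∈ N.toSubgroup, ∀ x ∈ K, ofG k G n • x - x ∈ L₀) (hL : L₀ ≤ L)
    {x₁ : X} (hx₁ : x₁ ∉ K) (hx₁L : ofG k G d₀ • x₁ - x₁ ∈ L)
    {n : G} (hn : n ∈ N.toSubgroup) (x : X) : ofG k G n • x - x ∈ L := by
  obtain ⟨M, hM⟩ := hX.exists_level (hL₀.mem_nhds L₀.zero_mem)
  let T : Submodule k X :=
    { carrier := {x | ∀ n ∈ N.toSubgroup, ofG k G n • x - x ∈ L}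
      add_mem' := fun {x y} hx hy n hn => by
        rw [smul_add, add_sub_add_comm]
        exact add_mem (hx n hn) (hy n hn)
      zero_mem' := fun n _ => by
        rw [smul_zero, sub_zero]
        exact zero_mem _
      smul_mem' := fun c x hx n hn => by
        rw [smul_comm, ← smul_sub]
        exact (L.restrictScalars k).smul_mem c (hx n hn) }
  have hT : ∀ g : G, ∀ x ∈ T, ofG k G g • x ∈ T := by
    intro g x hx n hn
    have h1 := L.smul_mem (ofG k G g) (hx (g⁻¹ * n * g)
      (by simpa using N.isNormal'.conj_mem n hn g⁻¹))
    rw [smul_sub, ← mul_smul, ← map_mul] at h1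
    rw [← mul_smul, ← map_mul]
    convert h1 using 4
    group
  let T' : Submodule (CGA k G) X :=
    { T with
      smul_mem' := fun a x hx => smul_mem_of_ofG_smul_mem M T (fun a ha n hn => by
        exact hL (sub_mem (L₀.smul_mem _ (hM a ha x)) (hM a ha x))) (fun g => hT g x hx) a }
  have hKT : K < T' := by
    refine SetLike.lt_iff_le_and_exists.2 ⟨fun x hx n hn => hL (hNL n hn x hx), x₁, ?_, hx₁⟩
    intro n hn
    have h1 := hD.smul_sub_mem_sup_span hd hX hXe hd₀ hL₀ hK.1 hNK hNL hn x₁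
    have h2 : L₀.restrictScalars k ⊔ Submodule.span k {ofG k G d₀ • x₁ - x₁} ≤
        L.restrictScalars k :=
      sup_le hL ((Submodule.span_singleton_le_iff_mem _ _).2 hx₁L)
    exact h2 h1
  exact ((hK.2 _ hKT).ge Submodule.mem_top : x ∈ T') n hn

theorem isOpen_sup_map_subtype (hX : IsPseudocompactMod k (CGA k G) X)
    {K₁ K₂ : Submodule (CGA k G) X} (hK₁ : IsClosed (K₁ : Set X)) (hK₂ : IsClosed (K₂ : Set X))
    (hK : IsOpen ((K₁ ⊔ K₂ : Submodule (CGA k G) X) : Set X))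
    {J₁ : Submodule (CGA k G) K₁} {J₂ : Submodule (CGA k G) K₂}
    (hJ₁ : IsOpen (J₁ : Set K₁)) (hJ₂ : IsOpen (J₂ : Set K₂)) :
    IsOpen ((J₁.map K₁.subtype ⊔ J₂.map K₂.subtype : Submodule (CGA k G) X) : Set X) := by
  have := hX.addGroup
  have hKc := hX.of_isClosed (isClosed_of_submodule_isOpen hK)
  have hP := (hX.of_isClosed hK₁).prod (hX.of_isClosed hK₂)
  let s : K₁ × K₂ →ₗ[CGA k G] (K₁ ⊔ K₂ : Submodule (CGA k G) X) :=
    (K₁.subtype.coprod K₂.subtype).codRestrict _ fun y => Submodule.add_mem_sup y.1.2 y.2.2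
  have hs : Continuous s := by
    refine Continuous.subtype_mk ?_ _
    exact (continuous_subtype_val.comp continuous_fst).add
      (continuous_subtype_val.comp continuous_snd)
  have hss : Function.Surjective s := by
    rintro ⟨x, hx⟩
    obtain ⟨y, hy, z, hz, rfl⟩ := Submodule.mem_sup.1 hx
    exact ⟨(⟨y, hy⟩, ⟨z, hz⟩), rfl⟩
  have h1 := hP.isLinCpt.isOpen_map hKc.isLinTop (s.restrictScalars k) hs hss
    (V := (J₁.prod J₂).restrictScalars k) (hJ₁.prod hJ₂)
  have h2 := hK.isOpenMap_subtype_val _ h1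
  refine isOpen_of_submodule_le (V := ((J₁.prod J₂).map s).map (K₁ ⊔ K₂).subtype) ?_ h2
  rintro _ ⟨_, ⟨⟨y, z⟩, ⟨hy, hz⟩, rfl⟩, rfl⟩
  exact Submodule.add_mem_sup ⟨y, hy, rfl⟩ ⟨z, hz, rfl⟩

end Decomposition

section Indecomposable

variable {k G} [IsTopologicalGroup G] [CompactSpace G] [TotallyDisconnectedSpace G] [T2Space G]
  {p : ℕ} [Fact p.Prime] [CharP k p]
  {X : Type} [AddCommGroup X] [Module k X] [Module (CGA k G) X]
  [IsScalarTower k (CGA k G) X] [TopologicalSpace X]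

theorem mem_of_mem_sup_map_subtype {A : Type} [Ring A] [Module A X]
    {K₁ K₂ : Submodule A X} (hK : Disjoint K₁ K₂)
    {J₁ : Submodule A K₁} {J₂ : Submodule A K₂} {x : K₁}
    (hx : (x : X) ∈ J₁.map K₁.subtype ⊔ J₂.map K₂.subtype) : x ∈ J₁ := by
  obtain ⟨_, ⟨y, hy, rfl⟩, _, ⟨z, -, rfl⟩, hyz⟩ := Submodule.mem_sup.1 hx
  have h1 : (x : X) - y = z := sub_eq_of_eq_add' hyz.symm
  have h2 := Submodule.disjoint_def.1 hK _ (sub_mem x.2 y.2) (h1 ▸ z.2)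
  rwa [show x = y from Subtype.ext (sub_eq_zero.1 h2)]

theorem inf_sup_map_subtype_le {A : Type} [Ring A] [Module A X]
    {K₁ K₂ : Submodule A X} (hK : Disjoint K₁ K₂)
    (J₁ : Submodule A K₁) (J₂ : Submodule A K₂) :
    (K₁ ⊔ J₂.map K₂.subtype) ⊓ (J₁.map K₁.subtype ⊔ K₂) ≤
      J₁.map K₁.subtype ⊔ J₂.map K₂.subtype := by
  rintro x ⟨hx, hx'⟩
  obtain ⟨y, hy, z, hz, rfl⟩ := Submodule.mem_sup.1 hx
  obtain ⟨y', hy', z', hz', h⟩ := Submodule.mem_sup.1 hx'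
  have h1 : y - y' = z' - z := by
    rw [sub_eq_sub_iff_add_eq_add, ← h, add_comm]
  have h2 := Submodule.disjoint_def.1 hK _ (sub_mem hy (Submodule.map_subtype_le _ _ hy'))
    (h1 ▸ sub_mem hz' (Submodule.map_subtype_le _ _ hz))
  rw [sub_eq_zero.1 h2]
  exact Submodule.add_mem_sup hy' hz

theorem IsPCProjective.eq_bot_or_eq_bot {e : CGA k G} (hec : e ∈ Set.center (CGA k G))
    (hei : IsIdempotentElem e) {D : Subgroup G} (hD : DefectProp k G e D)
    {d : G} (hd : IsZpGenerator p D d) (hX : IsPseudocompactMod k (CGA k G) X)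
    (hXe : InBlock (CGA k G) (X := X) e) (hproj : IsPCProjective k G X)
    {K K₁ K₂ : Submodule (CGA k G) X} (hK : IsCoatom K) (hKo : IsOpen (K : Set X))
    (hKmax : ∀ W : Submodule (CGA k G) X, IsOpen (W : Set X) → W ≠ ⊤ → W ≤ K)
    (hK₁ : IsClosed (K₁ : Set X)) (hK₂ : IsClosed (K₂ : Set X))
    (hdisj : Disjoint K₁ K₂) (hsup : K₁ ⊔ K₂ = K) : K₁ = ⊥ ∨ K₂ = ⊥ := by
  by_contra! hne
  have := hX.addGroup
  have hV : ∀ K' : Submodule (CGA k G) X, IsClosed (K' : Set X) → K' ≠ ⊥ →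
      ∃ V : Submodule (CGA k G) K', IsOpen (V : Set K') ∧
        FiniteDimensional k (K' ⧸ V.restrictScalars k) ∧ V ≠ ⊤ ∧
        ∃ N : OpenNormalSubgroup G, ∀ a ∈ levelIdeal k N, ∀ x : K', a • x ∈ V := by
    intro K' hK' hK'0
    have hpc := hX.of_isClosed hK'
    have := hpc.t2
    obtain ⟨u, hu, hu0⟩ := Submodule.exists_mem_ne_zero_of_ne_bot hK'0
    obtain ⟨V, hV, hVf, hVu⟩ := hpc.exists_submodule
      ((isOpen_compl_singleton (x := (⟨u, hu⟩ : K'))).mem_nhds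
        fun h => hu0 (congrArg Subtype.val h).symm)
    obtain ⟨N, hN⟩ := hpc.exists_level (hV.mem_nhds V.zero_mem)
    exact ⟨V, hV, hVf, fun h => hVu (h ▸ Submodule.mem_top) rfl, N, hN⟩
  obtain ⟨V₁, hV₁, _, hV₁t, N₁, hN₁⟩ := hV K₁ hK₁ hne.1
  obtain ⟨V₂, hV₂, _, hV₂t, N₂, hN₂⟩ := hV K₂ hK₂ hne.2
  obtain ⟨N₀, hN₀⟩ := hX.exists_level (hKo.mem_nhds K.zero_mem)
  obtain ⟨N, hN⟩ := exists_openNormalSubgroup_le {N₀, N₁, N₂} (by simp)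
  have hNK : ∀ n ∈ N.toSubgroup, ∀ x : X, ofG k G n • x - x ∈ K := by
    intro n hn x
    have h1 := ofG_sub_ofG_mem (k := k) (N := N) (g := n) (h := 1)
      ((QuotientGroup.eq_one_iff _).2 hn)
    have h2 := hN₀ _ (levelIdeal_mono (hN N₀ (by simp)) h1) x
    rwa [map_one, sub_smul, one_smul] at h2
  obtain ⟨J₁, hJ₁, hJ₁N, hext₁⟩ :=
    (IsPCProjective.of_isClosed hec hei hD hd hX hXe hproj hK₁).exists_extension_of_disjoint hX
      (hX.of_isClosed hK₁) hV₁ fun a ha => hN₁ a (levelIdeal_mono (hN N₁ (by simp)) ha)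
  obtain ⟨J₂, hJ₂, hJ₂N, hext₂⟩ :=
    (IsPCProjective.of_isClosed hec hei hD hd hX hXe hproj hK₂).exists_extension_of_disjoint hX
      (hX.of_isClosed hK₂) hV₂ fun a ha => hN₂ a (levelIdeal_mono (hN N₂ (by simp)) ha)
  set L₀ := J₁.map K₁.subtype ⊔ J₂.map K₂.subtype with hL₀
  have hL₀o : IsOpen (L₀ : Set X) :=
    isOpen_sup_map_subtype hX hK₁ hK₂ (hsup.symm ▸ hKo) hJ₁ hJ₂
  have hNL : ∀ n ∈ N.toSubgroup, ∀ x ∈ K, ofG k G n • x - x ∈ L₀ := by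
    intro n hn x hx
    obtain ⟨y, hy, z, hz, rfl⟩ := Submodule.mem_sup.1 (hsup.ge hx)
    rw [smul_add, add_sub_add_comm]
    exact Submodule.add_mem_sup ⟨_, hJ₁N n hn ⟨y, hy⟩, rfl⟩ ⟨_, hJ₂N n hn ⟨z, hz⟩, rfl⟩
  obtain ⟨d₀, hd₀⟩ := (Subgroup.isCyclic_iff_exists_zpowers_eq_top _).1
    (Subgroup.isCyclic_of_le (inf_le_left : Subgroup.zpowers d ⊓ N.toSubgroup ≤ _))
  have hd₀N : d₀ ∈ N.toSubgroup := (hd₀.le (Subgroup.mem_zpowers d₀)).2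
  let R : Submodule k X := L₀.restrictScalars k ⊔
    LinearMap.range (actHom (k := k) X d₀ - LinearMap.id)
  have hRo : IsOpen (R : Set X) :=
    isOpen_of_submodule_le (V := L₀.restrictScalars k) le_sup_left hL₀o
  have hRN : ∀ n ∈ N.toSubgroup, ∀ x : X, ofG k G n • x - x ∈ R := by
    intro n hn x
    refine (sup_le_sup_left ?_ _ : _ ≤ R)
      (hD.smul_sub_mem_sup_span hd hX hXe hd₀.symm hL₀o hK.1 hNK hNL hn x)
    exact (Submodule.span_singleton_le_iff_mem _ _).2 ⟨x, rfl⟩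
  have hR : ∀ L : Submodule (CGA k G) X, L₀ ≤ L → ∀ x ∈ R, x ∈ L → x ∉ L₀ →
      ∀ y : X, ofG k G d₀ • y - y ∈ L := by
    intro L hL x hxR hxL hx₀
    obtain ⟨y, hy, _, ⟨x₁, rfl⟩, rfl⟩ := Submodule.mem_sup.1 hxR
    have hx₁ : x₁ ∉ K := fun h => hx₀ (add_mem hy (hNL _ hd₀N x₁ h))
    exact hD.smul_sub_mem_of_isCoatom hd hX hXe hd₀.symm hL₀o hK hNK hNL hL hx₁
      ((Submodule.add_mem_iff_right L (hL hy)).1 hxL) hd₀N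
  have hdich : (∀ x : K₁, (x : X) ∈ R → x ∈ J₁) ∨ ∀ x : K₂, (x : X) ∈ R → x ∈ J₂ := by
    by_contra! h
    obtain ⟨⟨x, hxR, hxJ⟩, y, hyR, hyJ⟩ := h
    have hx₀ : (x : X) ∉ L₀ := fun h => hxJ (mem_of_mem_sup_map_subtype hdisj h)
    have hy₀ : (y : X) ∉ L₀ := fun h => hyJ (mem_of_mem_sup_map_subtype hdisj.symm
      (J₂ := J₁) (by rwa [sup_comm]))
    have h1 := hR (K₁ ⊔ J₂.map K₂.subtype) (sup_le_sup_right (Submodule.map_subtype_le _ _) _)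
      x hxR (Submodule.mem_sup_left x.2) hx₀
    have h2 := hR (J₁.map K₁.subtype ⊔ K₂) (sup_le_sup_left (Submodule.map_subtype_le _ _) _)
      y hyR (Submodule.mem_sup_right y.2) hy₀
    refine hx₀ ((sup_le le_rfl ?_ : R ≤ L₀.restrictScalars k) hxR)
    rintro _ ⟨z, rfl⟩
    exact inf_sup_map_subtype_le hdisj J₁ J₂ ⟨h1 z, h2 z⟩
  rcases hdich with h | h
  · exact not_exists_extension hK.1 hKmax (hsup ▸ le_sup_left) hV₁t (hext₁ R hRo hRN h)
  · exact not_exists_extension hK.1 hKmax (hsup ▸ le_sup_right) hV₂t (hext₂ R hRo hRN h)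

theorem IsPCProjective.isIndecTop_of_le_radical {e : CGA k G} (hec : e ∈ Set.center (CGA k G))
    (hei : IsIdempotentElem e) {D : Subgroup G} (hD : DefectProp k G e D)
    {d : G} (hd : IsZpGenerator p D d) (hX : IsPseudocompactMod k (CGA k G) X)
    (hXe : InBlock (CGA k G) (X := X) e) (hproj : IsPCProjective k G X)
    {K : Submodule (CGA k G) X} (hK : IsCoatom K) (hKr : K ≤ radical (CGA k G) X) :
    IsPCProjective k G K ∧ IsIndecTop (CGA k G) K := by
  have := hX.addGroup
  have hKo := isOpen_of_isCoatom_of_le_radical hX hK hKr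
  have hKc := isClosed_of_submodule_isOpen hKo
  refine ⟨IsPCProjective.of_isClosed hec hei hD hd hX hXe hproj hKc, ?_, fun W W' hW hW' hWW' => ?_⟩
  · rw [Submodule.nontrivial_iff_ne_bot]
    rintro rfl
    have := hproj.subsingleton_of_isOpen_bot hX hKo hd
    exact hK.1 (Subsingleton.elim _ _)
  · have hcl : ∀ W : Submodule (CGA k G) K, IsClosed (W : Set K) →
        IsClosed (W.map K.subtype : Set X) := fun W hW =>
      hKc.isClosedEmbedding_subtypeVal.isClosedMap _ hW
    have h1 := hproj.eq_bot_or_eq_bot hec hei hD hd hX hXe hK hKo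
      (fun W hW hWt => (le_of_isCoatom_of_le_radical hX hK hKr hW hWt).1) (hcl W hW) (hcl W' hW')
      ((Submodule.disjoint_map K.injective_subtype) hWW'.disjoint)
      (by rw [← Submodule.map_sup, hWW'.sup_eq_top, Submodule.map_subtype_top])
    have hbot : ∀ W : Submodule (CGA k G) K, W.map K.subtype = ⊥ → W = ⊥ := fun W h =>
      Submodule.map_injective_of_injective K.injective_subtype (h.trans (Submodule.map_bot _).symm)
    exact h1.imp (hbot W) (hbot W')

end Indecomposable

/-- Corollary 5.3(2): a block of a profinite group with defect
group `ℤ_p` has global dimension `1` (in the category of pseudocompact modules):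
the kernel of any continuous surjection from a projective pseudocompact module of
the block onto a pseudocompact module of the block is again projective, some module
of the block is not projective; in particular the kernel of the projective cover
`P_S → S` of any simple module is an indecomposable projective module. -/
theorem block_with_Zp_defect_has_global_dimension_one
    (p : ℕ) [Fact p.Prime] (k : Type) [Field k] [CharP k p] [IsAlgClosed k]
    (G : Type) [Group G] [TopologicalSpace G] [IsTopologicalGroup G]
    [CompactSpace G] [TotallyDisconnectedSpace G] [T2Space G]
    (e : CGA k G) (he : IsBlockIdem (CGA k G) e)
    (D : Subgroup G) (hD : IsDefectGroup k G e D)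
    (hZp : IsZpGroup G p D) :
    -- global dimension at most one: first syzygies of modules of the block are
    -- projective
    (∀ (W : Type) [AddCommGroup W] [Module k W] [Module (CGA k G) W]
       [IsScalarTower k (CGA k G) W] [TopologicalSpace W],
     ∀ (Q : Type) [AddCommGroup Q] [Module k Q] [Module (CGA k G) Q]
       [IsScalarTower k (CGA k G) Q] [TopologicalSpace Q],
       IsPseudocompactMod k (CGA k G) W → InBlock (CGA k G) (X := W) e →
       IsPseudocompactMod k (CGA k G) Q → InBlock (CGA k G) (X := Q) e →
       IsPCProjective k G Q →
       ∀ f : Q →ₗ[CGA k G] W, Continuous f → Function.Surjective f →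
         IsPCProjective k G (LinearMap.ker f)) ∧
    -- global dimension exactly one: some module of the block is not projective
    (∃ m : Submodule (CGA k G) (CGA k G),
      IsSimpleModule (CGA k G) ((CGA k G) ⧸ m) ∧
      InBlock (CGA k G) (X := (CGA k G) ⧸ m) e ∧
      ¬ IsPCProjective k G ((CGA k G) ⧸ m)) ∧
    -- in particular: the kernel of a projective cover of a simple module is an
    -- indecomposable projective module
    (∀ (S : Type) [AddCommGroup S] [Module (CGA k G) S],
      IsSimpleModule (CGA k G) S → InBlock (CGA k G) (X := S) e →
      ∀ (P : Type) [AddCommGroup P] [Module k P] [Module (CGA k G) P]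
        [IsScalarTower k (CGA k G) P] [TopologicalSpace P],
        IsProjCover k G e P S →
        ∀ π : P →ₗ[CGA k G] S, Function.Surjective π →
          LinearMap.ker π ≤ radical (CGA k G) P →
            IsPCProjective k G (LinearMap.ker π) ∧
            IsIndecTop (CGA k G) (LinearMap.ker π)) := by
  obtain ⟨d, hd⟩ := hZp.exists_generator
  refine ⟨fun W _ _ _ _ _ Q _ _ _ _ _ hW _ hQ hQe hproj f hf _ => ?_,
    exists_simple_not_projective he.central he.idem he.ne_zero hd,
    fun S _ _ hS _ P _ _ _ _ _ hcov π hπ hπr => ?_⟩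
  · have := hW.t2
    exact hproj.of_isClosed he.central he.idem hD.defect hd hQ hQe
      (isClosed_eq hf continuous_const)
  · have hK : IsCoatom (LinearMap.ker π) := by
      rw [← isSimpleModule_iff_isCoatom]
      exact IsSimpleModule.congr (π.quotKerEquivOfSurjective hπ)
    exact hcov.projective.isIndecTop_of_le_radical he.central he.idem hD.defect hd
      hcov.pseudocompact hcov.inBlock hK hπr

end ProfiniteBlocks
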